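/- arXiv:1302.2379 — 3 statements merged into one kernel-verified Lean document; each statement's English description precedes it below -/
import Mathlib

section
/- Let n ≥ 1 and let F := FreeGroup (Fin n). Suppose Φ : F ≃* F is an automorphism that acts trivially on H₁(F; ℤ/3). If c ∈ F and k ≥ 1 are such that Φ^k(c) is conjugate to c in F, then Φ(c) is conjugate to c in F. (Every periodic conjugacy class of an element of IA_n(ℤ/3) is fixed; Theorem 4.1 of the paper, at the level of automorphism representatives.) -/
/-- An automorphism `Φ` of the free group acts trivially on `H₁(F; ℤ/3)`:
for every `x` there is `y` in the abelianization with
`Abelianization.of (Φ x) = Abelianization.of x * y ^ 3`. -/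
def ActsTriviallyOnH1Mod3 {n : ℕ}
    (Φ : FreeGroup (Fin n) ≃* FreeGroup (Fin n)) : Prop :=
  ∀ x : FreeGroup (Fin n), ∃ y : Abelianization (FreeGroup (Fin n)),
    Abelianization.of (Φ x) = Abelianization.of x * y ^ 3

theorem exists_pow_apply_eq_add_three_nsmul {M : Type*} [AddCommGroup M] {S : AddSubgroup M}
    {T : AddMonoid.End M} (hT : ∀ x ∈ S, ∃ y ∈ S, T x = x + 3 • y) (i : ℕ) :
    ∀ x ∈ S, ∃ y ∈ S, (T ^ i) x = x + 3 • y := by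
  induction i with
  | zero => exact fun x _ => ⟨0, S.zero_mem, by simp⟩
  | succ i ih =>
    intro x hx
    obtain ⟨y, hy, hxy⟩ := ih x hx
    obtain ⟨z, hz, hxz⟩ := hT x hx
    obtain ⟨t, ht, hyt⟩ := hT y hy
    refine ⟨z + (y + 3 • t), S.add_mem hz (S.add_mem hy (S.nsmul_mem ht 3)), ?_⟩
    rw [pow_succ', AddMonoid.End.coe_mul, Function.comp_apply, hxy, map_add, map_nsmul, hxz, hyt]
    abel

theorem Int.eq_zero_of_forall_three_pow_dvd {m : ℤ} (h : ∀ j : ℕ, (3 : ℤ) ^ j ∣ m) : m = 0 := by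
  by_contra hm
  obtain ⟨j, hj⟩ := (Int.finiteMultiplicity_iff (a := 3) (b := m)).2 ⟨by decide, hm⟩
  exact hj (h _)

/-- The prime case of `apply_eq_of_apply_pow_eq`. -/
theorem apply_eq_of_apply_prime_pow_eq {M : Type*} [AddCommGroup M] {S : AddSubgroup M}
    (w : M →+ ℤ) {p : ℕ} (hp : p.Prime) {T : AddMonoid.End M}
    (hT : ∀ x ∈ S, ∃ y ∈ S, T x = x + 3 • y) (hw : ∀ x ∈ S, w ((T ^ p) x) = w x) :
    ∀ x ∈ S, w (T x) = w x := by
  set v : M →+ ℤ := w.comp T - w with hv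
  have hvx : ∀ x, v x = w (T x) - w x := fun x => rfl
  have hsum : ∀ x ∈ S, ∑ i ∈ Finset.range p, v ((T ^ i) x) = 0 := by
    intro x hx
    have := Finset.sum_range_sub (fun i => w ((T ^ i) x)) p
    simp only [pow_zero, hw x hx, AddMonoid.End.one_apply, sub_self] at this
    rw [← this]
    exact Finset.sum_congr rfl fun i _ => by
      rw [hvx, pow_succ', AddMonoid.End.coe_mul, Function.comp_apply]
  have key : ∀ j : ℕ, ∀ x ∈ S, (3 : ℤ) ^ j ∣ v x := by
    intro j
    induction j with
    | zero => simp
    | succ j ih =>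
      intro x hx
      by_cases h3 : p = 3
      · subst h3
        have h := hsum x hx
        obtain ⟨y, hy, hxy⟩ := hT x hx
        obtain ⟨z, hz, hyz⟩ := hT y hy
        simp only [Finset.sum_range_succ, Finset.sum_range_zero, pow_zero, pow_one, pow_two,
          AddMonoid.End.one_apply, AddMonoid.End.coe_mul, Function.comp_apply, hxy, hyz, map_add,
          map_nsmul, nsmul_eq_mul, Nat.cast_ofNat] at h
        obtain ⟨a, ha⟩ := ih y hy
        obtain ⟨b, hb⟩ := ih z hz
        rw [ha, hb] at h
        exact ⟨-a - b, by rw [pow_succ]; linarith⟩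
      · choose! y hy hxy using fun i => exists_pow_apply_eq_add_three_nsmul hT i x hx
        have h := hsum x hx
        simp only [hxy, map_add, map_nsmul, Finset.sum_add_distrib, Finset.sum_const,
          Finset.card_range, ← Finset.smul_sum] at h
        obtain ⟨a, ha⟩ := Finset.dvd_sum (s := Finset.range p) fun i _ => ih (y i) (hy i)
        rw [ha] at h
        simp only [nsmul_eq_mul] at h
        push_cast at h
        have hcop : IsCoprime ((3 : ℤ) ^ (j + 1)) (p : ℤ) := by
          apply IsCoprime.pow_left
          exact_mod_cast Nat.isCoprime_iff_coprime.2
            ((Nat.coprime_primes Nat.prime_three hp).2 (Ne.symm h3))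
        refine hcop.dvd_of_dvd_mul_left ⟨-a, ?_⟩
        rw [pow_succ]
        linarith
  intro x hx
  have := Int.eq_zero_of_forall_three_pow_dvd fun j => key j x hx
  rw [hvx] at this
  linarith

/-- Minkowski's argument: if `T` is congruent to the identity modulo `3` on `S`, then every integral
functional which is invariant on `S` under some positive power of `T` is invariant under `T`. -/
theorem apply_eq_of_apply_pow_eq {M : Type*} [AddCommGroup M] {S : AddSubgroup M}
    (w : M →+ ℤ) {k : ℕ} (hk : k ≠ 0) {T : AddMonoid.End M}
    (hT : ∀ x ∈ S, ∃ y ∈ S, T x = x + 3 • y) (hw : ∀ x ∈ S, w ((T ^ k) x) = w x) :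
    ∀ x ∈ S, w (T x) = w x := by
  induction k using induction_on_primes generalizing T with
  | zero => exact absurd rfl hk
  | one => simpa using hw
  | prime_mul p a hp ih =>
    refine ih (right_ne_zero_of_mul hk) hT ?_
    exact apply_eq_of_apply_prime_pow_eq w hp (exists_pow_apply_eq_add_three_nsmul hT a)
      (by rwa [← pow_mul, mul_comm])

/-- The integral traces on `R` which take values divisible by `3 ^ k` on `I ^ k`. -/
def integralTraces {R : Type*} [Ring R] (I : Submodule ℤ R) : AddSubgroup (R →+ ℤ) where
  carrier := {L | (∀ a b, L (a * b) = L (b * a)) ∧ ∀ k, ∀ z ∈ I ^ k, (3 : ℤ) ^ k ∣ L z}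
  zero_mem' := by simp
  add_mem' := fun ⟨h₁, h₂⟩ ⟨h₃, h₄⟩ =>
    ⟨fun a b => by simp [h₁ a b, h₃ a b], fun k z hz => dvd_add (h₂ k z hz) (h₄ k z hz)⟩
  neg_mem' := fun ⟨h₁, h₂⟩ => ⟨fun a b => by simp [h₁ a b], fun k z hz => (h₂ k z hz).neg_right⟩

theorem sub_mem_pow_succ {R : Type*} [Ring R] {I : Submodule ℤ R} {Ψ : R →+* R}
    (hI : ∀ z ∈ I, Ψ z ∈ I) (hΨ : ∀ z, Ψ z - z ∈ I ^ 2) (k : ℕ) :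
    ∀ z ∈ I ^ k, Ψ z - z ∈ I ^ (k + 1) := by
  intro z hz
  induction hz using Submodule.pow_induction_on_left' with
  | algebraMap r => simp [sub_self]
  | add x y i hx hy ihx ihy =>
    rw [map_add, add_sub_add_comm]
    exact add_mem ihx ihy
  | mem_mul m hm i x hx ih =>
    have : Ψ (m * x) - m * x = Ψ m * (Ψ x - x) + (Ψ m - m) * x := by
      rw [map_mul]; noncomm_ring
    rw [this]
    refine add_mem ?_ ?_
    · rw [Nat.succ_eq_add_one, Submodule.pow_succ' _ (Nat.succ_ne_zero i)]
      exact Submodule.mul_mem_mul (hI m hm) ih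
    · have h := Submodule.mul_mem_mul (hΨ m) hx
      rcases Nat.eq_zero_or_pos i with rfl | hi
      · rw [Submodule.pow_zero, mul_one] at h
        exact h
      · rw [← Submodule.pow_add _ hi.ne'] at h
        convert h using 2
        omega

theorem exists_integralTraces_comp_eq {R : Type*} [Ring R] {I : Submodule ℤ R} {Ψ : R →+* R}
    (hI : ∀ z ∈ I, Ψ z ∈ I) (hI2 : I ^ 2 ≤ I) (hΨ : ∀ z, Ψ z - z ∈ I ^ 2)
    {L : R →+ ℤ} (hL : L ∈ integralTraces I) :
    ∃ L' ∈ integralTraces I, L.comp Ψ.toAddMonoidHom = L + 3 • L' := by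
  have h3 : ∀ z, (3 : ℤ) ∣ L (Ψ z) - L z := by
    intro z
    rw [← map_sub, ← pow_one (3 : ℤ)]
    exact hL.2 1 _ (by rw [Submodule.pow_one]; exact hI2 (hΨ z))
  choose f hf using h3
  let L' : R →+ ℤ := AddMonoidHom.mk' f fun a b => by
    have h := hf (a + b)
    simp only [map_add] at h
    linarith [hf a, hf b]
  have hL' : ∀ z, L (Ψ z) - L z = 3 * L' z := hf
  refine ⟨L', ⟨fun a b => ?_, fun k z hz => ?_⟩, ?_⟩
  · have h₁ := hL' (a * b)
    have h₂ := hL' (b * a)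
    rw [map_mul, hL.1 (Ψ a), ← map_mul, hL.1 a b] at h₁
    linarith
  · have h := hL.2 _ _ (sub_mem_pow_succ hI hΨ k z hz)
    rw [map_sub, hL', pow_succ'] at h
    exact (mul_dvd_mul_iff_left (by norm_num)).1 h
  · ext z
    change L (Ψ z) = L z + 3 • L' z
    rw [nsmul_eq_mul]
    exact eq_add_of_sub_eq' (hL' z)

/-- If `Ψ` is trivial modulo `I ^ 2`, an element whose traces are invariant under a positive power
of `Ψ` has traces invariant under `Ψ`. -/
theorem integralTraces_apply_eq {R : Type*} [Ring R] {I : Submodule ℤ R} {Ψ : R →+* R}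
    (hI : ∀ z ∈ I, Ψ z ∈ I) (hI2 : I ^ 2 ≤ I) (hΨ : ∀ z, Ψ z - z ∈ I ^ 2) {k : ℕ} (hk : k ≠ 0)
    {z : R} (hz : ∀ L ∈ integralTraces I, L ((Ψ ^ k) z) = L z) :
    ∀ L ∈ integralTraces I, L (Ψ z) = L z := by
  let T : AddMonoid.End (R →+ ℤ) := AddMonoidHom.compHom' Ψ.toAddMonoidHom
  have hTpow : ∀ (i : ℕ) (L : R →+ ℤ) (x : R), (T ^ i) L x = L ((Ψ ^ i) x) := by
    intro i
    induction i with
    | zero => simp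
    | succ i ih =>
      intro L x
      rw [pow_succ, AddMonoid.End.coe_mul, Function.comp_apply, ih, pow_succ']
      rfl
  refine apply_eq_of_apply_pow_eq (AddMonoidHom.eval z) hk (T := T)
    (fun L hL => exists_integralTraces_comp_eq hI hI2 hΨ hL) fun L hL => ?_
  exact (hTpow k L z).trans (hz L hL)

/-- The preimage of `3ℤ` under a ring homomorphism `R → ℤ`. -/
def augmentationMod3 {R : Type*} [Ring R] (ε : R →+* ℤ) : Submodule ℤ R :=
  AddSubgroup.toIntSubmodule ((AddSubgroup.zmultiples 3).comap ε.toAddMonoidHom)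

theorem mem_augmentationMod3 {R : Type*} [Ring R] {ε : R →+* ℤ} {z : R} :
    z ∈ augmentationMod3 ε ↔ (3 : ℤ) ∣ ε z :=
  Int.mem_zmultiples_iff

theorem sub_one_mem_augmentationMod3 {R : Type*} [Ring R] {ε : R →+* ℤ} {a : R} (h : ε a = 1) :
    a - 1 ∈ augmentationMod3 ε := by
  rw [mem_augmentationMod3, map_sub, h, map_one, sub_self]
  exact dvd_zero 3

/-- The homomorphism `g ↦ u g - 1` from `G` to the additive group `R / I ^ 2`, where `I` is
`augmentationMod3 ε` and `u` takes values in elements of augmentation `1`. -/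
def toAugmentationQuotient {R G : Type*} [Ring R] [Group G] {ε : R →+* ℤ} {u : G →* R}
    (hu : ∀ g, ε (u g) = 1) : G →* Multiplicative (R ⧸ augmentationMod3 ε ^ 2) where
  toFun g := .ofAdd (Submodule.Quotient.mk (u g - 1))
  map_one' := by rw [map_one, sub_self, Submodule.Quotient.mk_zero, ofAdd_zero]
  map_mul' g h := by
    rw [← ofAdd_add, ← Submodule.Quotient.mk_add]
    congr 1
    rw [Submodule.Quotient.eq, pow_two]
    convert Submodule.mul_mem_mul (sub_one_mem_augmentationMod3 (hu g))
      (sub_one_mem_augmentationMod3 (hu h)) using 1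
    rw [map_mul]
    noncomm_ring

theorem sub_mem_augmentationMod3_sq {R G : Type*} [Ring R] [Group G] {ε : R →+* ℤ} {u : G →* R}
    (hu : ∀ g, ε (u g) = 1) {x x' : G} {y : Abelianization G}
    (h : Abelianization.of x' = Abelianization.of x * y ^ 3) :
    u x' - u x ∈ augmentationMod3 ε ^ 2 := by
  obtain ⟨y, rfl⟩ : ∃ g, Abelianization.of g = y := QuotientGroup.mk_surjective y
  have h' := congrArg (Abelianization.lift (toAugmentationQuotient hu)) h
  rw [map_mul, map_pow] at h'
  simp only [Abelianization.lift_apply_of] at h'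
  have hy : toAugmentationQuotient hu y ^ 3 = 1 := by
    apply Multiplicative.toAdd.injective
    rw [toAdd_pow, toAdd_one]
    change 3 • (Submodule.Quotient.mk (u y - 1) : R ⧸ augmentationMod3 ε ^ 2) = 0
    rw [← Submodule.Quotient.mk_smul, Submodule.Quotient.mk_eq_zero, pow_two, nsmul_eq_mul]
    refine Submodule.mul_mem_mul ?_ (sub_one_mem_augmentationMod3 (hu y))
    rw [mem_augmentationMod3, map_natCast]
    simp
  rw [hy, mul_one] at h'
  have h'' := (Submodule.Quotient.eq _).1 (Multiplicative.ofAdd.injective h')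
  rwa [sub_sub_sub_cancel_right] at h''

/-- The augmentation of the integral group ring. -/
noncomputable def groupRingAugmentation (G : Type*) [Group G] : MonoidAlgebra ℤ G →+* ℤ :=
  (MonoidAlgebra.lift ℤ ℤ G 1).toRingHom

theorem groupRingAugmentation_of {G : Type*} [Group G] (g : G) :
    groupRingAugmentation G (MonoidAlgebra.of ℤ G g) = 1 := by
  simp [groupRingAugmentation]

theorem integralTraces_apply_of_isConj {G : Type*} [Group G] {g h : G} (hgh : IsConj g h) :
    ∀ L ∈ integralTraces (augmentationMod3 (groupRingAugmentation G)),
      L (MonoidAlgebra.of ℤ G g) = L (MonoidAlgebra.of ℤ G h) := by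
  intro L hL
  obtain ⟨x, rfl⟩ := isConj_iff.1 hgh
  rw [map_mul, hL.1, ← map_mul, inv_mul_cancel_left]

/-- An automorphism acting trivially on `H₁(G; ℤ/3)` and preserving the conjugacy class of `c` after
some positive number of iterations preserves the integral traces of `c`. -/
theorem integralTraces_apply_of_eq {G : Type*} [Group G] {Φ : G ≃* G}
    (hΦ : ∀ x, ∃ y, Abelianization.of (Φ x) = Abelianization.of x * y ^ 3) {k : ℕ} (hk : k ≠ 0)
    {c : G} (hc : IsConj ((Φ ^ k) c) c) :
    ∀ L ∈ integralTraces (augmentationMod3 (groupRingAugmentation G)),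
      L (MonoidAlgebra.of ℤ G (Φ c)) = L (MonoidAlgebra.of ℤ G c) := by
  let Ψ : MonoidAlgebra ℤ G →+* MonoidAlgebra ℤ G := MonoidAlgebra.mapDomainRingHom ℤ Φ.toMonoidHom
  have hof : ∀ g, Ψ (MonoidAlgebra.of ℤ G g) = MonoidAlgebra.of ℤ G (Φ g) := by simp [Ψ]
  have hpow : ∀ i g, (Ψ ^ i) (MonoidAlgebra.of ℤ G g) = MonoidAlgebra.of ℤ G ((Φ ^ i) g) := by
    intro i g
    induction i with
    | zero => rfl
    | succ i ih => rw [pow_succ', RingHom.mul_def, RingHom.comp_apply, ih, hof, pow_succ']; rfl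
  have hsub : ∀ z, Ψ z - z ∈ augmentationMod3 (groupRingAugmentation G) ^ 2 := by
    intro z
    induction z using MonoidAlgebra.induction_on with
    | of g =>
      rw [hof]
      obtain ⟨y, hy⟩ := hΦ g
      exact sub_mem_augmentationMod3_sq groupRingAugmentation_of hy
    | add a b ha hb => rw [map_add, add_sub_add_comm]; exact add_mem ha hb
    | smul r a ha =>
      rw [← Int.cast_smul_eq_zsmul ℤ, map_zsmul, ← smul_sub]
      exact Submodule.smul_mem _ r ha
  have haug : (groupRingAugmentation G).comp Ψ = groupRingAugmentation G := by
    ext g <;> simp [Ψ, groupRingAugmentation]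
  have hI : ∀ z ∈ augmentationMod3 (groupRingAugmentation G),
      Ψ z ∈ augmentationMod3 (groupRingAugmentation G) := by
    intro z hz
    rw [mem_augmentationMod3] at hz ⊢
    rwa [← RingHom.comp_apply, haug]
  have hI2 : augmentationMod3 (groupRingAugmentation G) ^ 2 ≤
      augmentationMod3 (groupRingAugmentation G) := by
    rw [pow_two, Submodule.mul_le]
    intro a ha b _
    rw [mem_augmentationMod3] at ha ⊢
    rw [map_mul]
    exact ha.mul_right _
  intro L hL
  rw [← hof]
  refine integralTraces_apply_eq hI hI2 hsub hk (fun L hL => ?_) L hL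
  rw [hpow]
  exact integralTraces_apply_of_isConj hc L hL

/-- A representation of `G` which is trivial modulo `3` turns traces into integral traces. -/
theorem comp_lift_mem_integralTraces {G B : Type*} [Group G] [Ring B] {r : G →* B}
    (hr : ∀ g, ∃ b, r g = 1 + 3 * b) {t : B →+ ℤ} (ht : ∀ a b, t (a * b) = t (b * a)) :
    t.comp (MonoidAlgebra.lift ℤ B G r).toRingHom.toAddMonoidHom ∈
      integralTraces (augmentationMod3 (groupRingAugmentation G)) := by
  set ρ : MonoidAlgebra ℤ G →+* B := (MonoidAlgebra.lift ℤ B G r).toRingHom with hρ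
  have hof : ∀ g, ρ (MonoidAlgebra.of ℤ G g) = r g := by simp [hρ]
  have hmod : ∀ z, ∃ b, ρ z = (groupRingAugmentation G z : B) + 3 * b := by
    intro z
    induction z using MonoidAlgebra.induction_on with
    | of g => rw [hof, groupRingAugmentation_of, Int.cast_one]; exact hr g
    | add x y hx hy =>
      obtain ⟨a, ha⟩ := hx
      obtain ⟨b, hb⟩ := hy
      exact ⟨a + b, by rw [map_add, map_add, ha, hb, Int.cast_add]; noncomm_ring⟩
    | smul m x hx =>
      obtain ⟨a, ha⟩ := hx
      refine ⟨m * a, ?_⟩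
      rw [← Int.cast_smul_eq_zsmul ℤ, map_zsmul, map_zsmul, ha, smul_eq_mul, Int.cast_mul,
        zsmul_eq_mul, mul_add, ← mul_assoc, ← mul_assoc, Int.cast_id,
        (Int.cast_commute m (3 : B)).eq]
  have hpow : ∀ k, ∀ z ∈ augmentationMod3 (groupRingAugmentation G) ^ k, ∃ b, ρ z = 3 ^ k * b := by
    intro k z hz
    induction hz using Submodule.pow_induction_on_left' with
    | algebraMap m => exact ⟨ρ m, by simp⟩
    | add x y i hx hy ihx ihy =>
      obtain ⟨a, ha⟩ := ihx
      obtain ⟨b, hb⟩ := ihy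
      exact ⟨a + b, by rw [map_add, ha, hb, mul_add]⟩
    | mem_mul m hm i x hx ih =>
      obtain ⟨a, ha⟩ := ih
      obtain ⟨b, hb⟩ := hmod m
      obtain ⟨q, hq⟩ := mem_augmentationMod3.1 hm
      refine ⟨(q + b) * a, ?_⟩
      have h3 : ∀ x : B, Commute ((3 : B) ^ i) x := fun x => (Nat.cast_commute 3 x).pow_left i
      rw [map_mul, ha, hb, hq]
      push_cast
      rw [← mul_add, mul_assoc, ← mul_assoc (_ + _), ← (h3 _).eq, pow_succ']
      simp only [mul_assoc]
  refine ⟨fun a b => ?_, fun k z hz => ?_⟩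
  · change t (ρ (a * b)) = t (ρ (b * a))
    rw [map_mul ρ, ht, map_mul ρ]
  · obtain ⟨b, hb⟩ := hpow k z hz
    refine ⟨t b, ?_⟩
    change t (ρ z) = _
    rw [hb, ← Nat.cast_ofNat (R := B), ← Nat.cast_pow, ← nsmul_eq_mul, map_nsmul, nsmul_eq_mul]
    push_cast
    rfl

/-- The matrix with entry `φ p` at `(p, σ p)` and zeros elsewhere. -/
def shiftMatrix {V : Type*} [DecidableEq V] (σ : V → V) (φ : V → ℤ) : Matrix V V ℤ :=
  Matrix.of fun p q => if q = σ p then φ p else 0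

/-- The product of the weights `φ a` along the `σ`-orbit of a point, for `a` in a list. -/
def pathWeight {V A : Type*} (σ : V → V) (φ : A → V → ℤ) : List A → V → ℤ
  | [], _ => 1
  | a :: l, p => φ a p * pathWeight σ φ l (σ p)

section ShiftMatrix

variable {V A : Type*}

theorem apply_ne_zero_of_pathWeight_ne_zero {σ : V → V} {φ : A → V → ℤ} {l : List A} {p : V}
    (h : pathWeight σ φ l p ≠ 0) (i : ℕ) (hi : i < l.length) : φ l[i] (σ^[i] p) ≠ 0 := by
  induction l generalizing p i with
  | nil => simp at hi
  | cons a l ih =>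
    cases i with
    | zero => exact left_ne_zero_of_mul h
    | succ i => exact ih (right_ne_zero_of_mul h) i (by simpa using hi)

theorem pathWeight_eq_prod {σ : V → V} {φ : A → V → ℤ} {κ : A → ℤ} {l : List A} {p : V}
    (h : ∀ i, (hi : i < l.length) → φ l[i] (σ^[i] p) = κ l[i]) :
    pathWeight σ φ l p = (l.map κ).prod := by
  induction l generalizing p with
  | nil => rfl
  | cons a l ih =>
    rw [List.map_cons, List.prod_cons, pathWeight]
    congr 1
    · exact h 0 (by simp)
    · exact ih fun i hi => h (i + 1) (by simpa using hi)

theorem pathWeight_eq_zero_or_prod {σ : V → V} {φ : A → V → ℤ} {κ : A → ℤ}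
    (hφ : ∀ a p, φ a p = 0 ∨ φ a p = κ a) (l : List A) (p : V) :
    pathWeight σ φ l p = 0 ∨ pathWeight σ φ l p = (l.map κ).prod := by
  rw [or_iff_not_imp_left]
  exact fun h => pathWeight_eq_prod fun i hi =>
    (hφ _ _).resolve_left (apply_ne_zero_of_pathWeight_ne_zero h i hi)

variable [DecidableEq V]

theorem shiftMatrix_mul [Fintype V] (σ τ : V → V) (φ ψ : V → ℤ) :
    shiftMatrix σ φ * shiftMatrix τ ψ = shiftMatrix (τ ∘ σ) fun p => φ p * ψ (σ p) := by
  ext p q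
  simp only [shiftMatrix, Matrix.mul_apply, Matrix.of_apply]
  rw [Finset.sum_eq_single (σ p)] <;> simp +contextual

theorem smul_shiftMatrix (m : ℤ) (σ : V → V) (φ : V → ℤ) :
    m • shiftMatrix σ φ = shiftMatrix σ fun p => m * φ p := by
  ext p q
  simp [shiftMatrix]

theorem shiftMatrix_list_prod [Fintype V] (σ : V → V) (φ : A → V → ℤ) (l : List A) :
    (l.map fun a => shiftMatrix σ (φ a)).prod = shiftMatrix σ^[l.length] (pathWeight σ φ l) := by
  induction l with
  | nil =>
    ext p q
    simp [shiftMatrix, pathWeight, Matrix.one_apply, eq_comm]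
  | cons a l ih =>
    rw [List.map_cons, List.prod_cons, ih, shiftMatrix_mul]
    rfl

theorem trace_shiftMatrix [Fintype V] (σ : V → V) (φ : V → ℤ) :
    (shiftMatrix σ φ).trace = ∑ p, if p = σ p then φ p else 0 := rfl

end ShiftMatrix

section PolynomialMatrix

open Polynomial

/-- For `N ^ 2 = 0`, the unit `1 + 3 N X` of the polynomial ring. -/
noncomputable def unipotentUnit {S : Type*} [Ring S] (N : S) (hN : N * N = 0) : S[X]ˣ where
  val := 1 + 3 * (C N * X)
  inv := 1 - 3 * (C N * X)
  val_inv := by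
    have h : C N * X * (C N * X) = 0 := by
      rw [mul_assoc, ← mul_assoc X, X_mul, mul_assoc, ← mul_assoc, ← C_mul, hN, C_0, zero_mul]
    calc _ = 1 - 9 * (C N * X * (C N * X)) := by noncomm_ring
      _ = 1 := by rw [h, mul_zero, sub_zero]
  inv_val := by
    have h : C N * X * (C N * X) = 0 := by
      rw [mul_assoc, ← mul_assoc X, X_mul, mul_assoc, ← mul_assoc, ← C_mul, hN, C_0, zero_mul]
    calc _ = 1 - 9 * (C N * X * (C N * X)) := by noncomm_ring
      _ = 1 := by rw [h, mul_zero, sub_zero]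

theorem val_unipotentUnit {S : Type*} [Ring S] (N : S) (hN : N * N = 0) :
    (unipotentUnit N hN).val = C ((3 : ℤ) • N) * X + C 1 := by
  change 1 + 3 * (C N * X) = _
  rw [map_zsmul, C_1, zsmul_eq_mul, mul_assoc, add_comm]
  simp

theorem val_inv_unipotentUnit {S : Type*} [Ring S] (N : S) (hN : N * N = 0) :
    ((unipotentUnit N hN)⁻¹).val = C ((-3 : ℤ) • N) * X + C 1 := by
  change 1 - 3 * (C N * X) = _
  rw [map_zsmul, C_1, zsmul_eq_mul, mul_assoc, sub_eq_neg_add]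
  simp

/-- The units of `B` which are trivial modulo `3`. -/
def unitsTrivialMod3 (B : Type*) [Ring B] : Submonoid Bˣ where
  carrier := {u | ∃ b, (u : B) = 1 + 3 * b}
  one_mem' := ⟨0, by simp⟩
  mul_mem' := by
    rintro u v ⟨a, ha⟩ ⟨b, hb⟩
    refine ⟨a + b + 3 * (a * b), ?_⟩
    rw [Units.val_mul, ha, hb]
    noncomm_ring

theorem unipotentUnit_mem {S : Type*} [Ring S] (N : S) (hN : N * N = 0) :
    unipotentUnit N hN ∈ unitsTrivialMod3 S[X] :=
  ⟨_, rfl⟩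

theorem unipotentUnit_inv_mem {S : Type*} [Ring S] (N : S) (hN : N * N = 0) :
    (unipotentUnit N hN)⁻¹ ∈ unitsTrivialMod3 S[X] :=
  ⟨-(C N * X), by rw [mul_neg, ← sub_eq_add_neg]; rfl⟩

/-- The trace of the `m`-th coefficient of a polynomial with matrix coefficients. -/
def coeffTrace (V : Type*) [Fintype V] [DecidableEq V] (m : ℕ) : (Matrix V V ℤ)[X] →+ ℤ where
  toFun p := (p.coeff m).trace
  map_zero' := by simp
  map_add' p q := by simp

theorem coeffTrace_mul_comm {V : Type*} [Fintype V] [DecidableEq V] (m : ℕ)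
    (p q : (Matrix V V ℤ)[X]) : coeffTrace V m (p * q) = coeffTrace V m (q * p) := by
  change ((p * q).coeff m).trace = ((q * p).coeff m).trace
  rw [coeff_mul, coeff_mul, Matrix.trace_sum, Matrix.trace_sum,
    ← Finset.Nat.sum_antidiagonal_swap]
  exact Finset.sum_congr rfl fun x _ => Matrix.trace_mul_comm _ _

theorem natDegree_mul_mul_le_three {S : Type*} [Ring S] (a b c : S) :
    ((C a * X + C 1) * (C b * X + C 1) * (C c * X + C 1)).natDegree ≤ 3 :=
  natDegree_mul_le_of_le (m := 2) (n := 1)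
    (natDegree_mul_le_of_le (m := 1) (n := 1) natDegree_linear_le natDegree_linear_le)
    natDegree_linear_le

theorem coeff_three_mul_mul {S : Type*} [Ring S] (a b c : S) :
    ((C a * X + C 1) * (C b * X + C 1) * (C c * X + C 1)).coeff 3 = a * b * c := by
  rw [show 3 = 2 + 1 from rfl, coeff_mul_add_eq_of_natDegree_le
    (natDegree_mul_le_of_le (m := 1) (n := 1) natDegree_linear_le natDegree_linear_le)
    natDegree_linear_le,
    coeff_mul_add_eq_of_natDegree_le natDegree_linear_le natDegree_linear_le]
  simp [coeff_one]

end PolynomialMatrix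

section CyclicWord

open Polynomial

variable {α : Type*} {s : ℕ}

/-- The successor on the cycle of length `3 s`, viewed as `s` consecutive blocks of length `3`. -/
def blockSucc (p : ZMod s × Fin 3) : ZMod s × Fin 3 :=
  ![(p.1, 1), (p.1, 2), (p.1 + 1, 0)] p.2

/-- The labelling of the cycle of length `3 s` obtained from a cyclic word `u` of length `s` by
replacing `x` with `(x, 0) (x, 1) (x, 2)` and `x⁻¹` with `(x, 2) (x, 1) (x, 0)`. -/
def blockLabel (u : ZMod s → α × Bool) (p : ZMod s × Fin 3) : α × Fin 3 :=
  ((u p.1).1, if (u p.1).2 then p.2 else p.2.rev)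

theorem blockLabel_blockSucc_ne {u : ZMod s → α × Bool}
    (hu : ∀ j, (u j).1 = (u (j + 1)).1 → (u j).2 = (u (j + 1)).2) (p : ZMod s × Fin 3) :
    blockLabel u (blockSucc p) ≠ blockLabel u p := by
  obtain ⟨j, i⟩ := p
  have h := hu j
  rcases hj : u j with ⟨y, b⟩
  rcases hj' : u (j + 1) with ⟨y', b'⟩
  rw [hj, hj'] at h
  fin_cases i <;> cases b <;> cases b' <;> simp_all [blockLabel, blockSucc, Fin.rev, eq_comm]

theorem iterate_block_shift (i : ℕ) (p : ZMod s × Fin 3) :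
    (fun p : ZMod s × Fin 3 => (p.1 + 1, p.2))^[i] p = (p.1 + i, p.2) := by
  induction i with
  | zero => simp
  | succ i ih =>
    rw [Function.iterate_succ_apply', ih]
    simp [add_assoc]

variable [DecidableEq α]

/-- The adjacency matrix of the edges of the labelled cycle with label `x`. -/
def edgeMatrix (u : ZMod s → α × Bool) (x : α × Fin 3) :
    Matrix (ZMod s × Fin 3) (ZMod s × Fin 3) ℤ :=
  shiftMatrix blockSucc fun p => if blockLabel u p = x then 1 else 0

variable [NeZero s] {u : ZMod s → α × Bool}

theorem edgeMatrix_mul_self (hu : ∀ j, (u j).1 = (u (j + 1)).1 → (u j).2 = (u (j + 1)).2)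
    (x : α × Fin 3) : edgeMatrix u x * edgeMatrix u x = 0 := by
  rw [edgeMatrix, shiftMatrix_mul]
  ext p q
  have h := blockLabel_blockSucc_ne hu p
  simp only [shiftMatrix, Matrix.of_apply, Matrix.zero_apply]
  grind

/-- The weight of a block of the cycle for the letter `x`: it is `± 27` on the blocks coming from
the letter `x`, and `0` elsewhere. -/
def blockWeight (u : ZMod s → α × Bool) (x : α × Bool) (p : ZMod s × Fin 3) : ℤ :=
  if p.2 = 0 ∧ u p.1 = x then (if x.2 then 27 else -27) else 0

theorem smul_edgeMatrix_mul_pos (x : α) :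
    (3 : ℤ) • edgeMatrix u (x, 0) * (3 : ℤ) • edgeMatrix u (x, 1) * (3 : ℤ) • edgeMatrix u (x, 2) =
      shiftMatrix (fun p => (p.1 + 1, p.2)) (blockWeight u (x, true)) := by
  simp only [edgeMatrix, smul_shiftMatrix, shiftMatrix_mul]
  congr 1
  · funext ⟨j, i⟩
    fin_cases i <;> rfl
  · funext ⟨j, i⟩
    rcases hj : u j with ⟨y, b⟩
    rcases hj' : u (j + 1) with ⟨y', b'⟩
    by_cases hy : y = x <;>
    fin_cases i <;> cases b <;> cases b' <;>
      simp [blockLabel, blockSucc, blockWeight, hj, hj', hy, Fin.rev]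

theorem smul_edgeMatrix_mul_neg (x : α) :
    (-3 : ℤ) • edgeMatrix u (x, 2) * (-3 : ℤ) • edgeMatrix u (x, 1) *
      (-3 : ℤ) • edgeMatrix u (x, 0) =
      shiftMatrix (fun p => (p.1 + 1, p.2)) (blockWeight u (x, false)) := by
  simp only [edgeMatrix, smul_shiftMatrix, shiftMatrix_mul]
  congr 1
  · funext ⟨j, i⟩
    fin_cases i <;> rfl
  · funext ⟨j, i⟩
    rcases hj : u j with ⟨y, b⟩
    rcases hj' : u (j + 1) with ⟨y', b'⟩
    by_cases hy : y = x <;>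
    fin_cases i <;> cases b <;> cases b' <;>
      simp [blockLabel, blockSucc, blockWeight, hj, hj', hy, Fin.rev]

/-- The image of the generator `x` under the representation attached to a cyclic word. -/
noncomputable def cycleUnit (hu : ∀ j, (u j).1 = (u (j + 1)).1 → (u j).2 = (u (j + 1)).2) (x : α) :
    (Matrix (ZMod s × Fin 3) (ZMod s × Fin 3) ℤ)[X]ˣ :=
  unipotentUnit _ (edgeMatrix_mul_self hu (x, 0)) *
    unipotentUnit _ (edgeMatrix_mul_self hu (x, 1)) *
    unipotentUnit _ (edgeMatrix_mul_self hu (x, 2))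

/-- The image of a letter under the representation attached to a cyclic word. -/
noncomputable def cycleLetter (hu : ∀ j, (u j).1 = (u (j + 1)).1 → (u j).2 = (u (j + 1)).2)
    (x : α × Bool) : (Matrix (ZMod s × Fin 3) (ZMod s × Fin 3) ℤ)[X]ˣ :=
  cond x.2 (cycleUnit hu x.1) (cycleUnit hu x.1)⁻¹

variable (hu : ∀ j, (u j).1 = (u (j + 1)).1 → (u j).2 = (u (j + 1)).2)

theorem val_cycleUnit (x : α) : (cycleUnit hu x).val =
    (C ((3 : ℤ) • edgeMatrix u (x, 0)) * X + C 1) * (C ((3 : ℤ) • edgeMatrix u (x, 1)) * X + C 1) *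
      (C ((3 : ℤ) • edgeMatrix u (x, 2)) * X + C 1) := by
  simp only [cycleUnit, Units.val_mul, val_unipotentUnit]

theorem val_inv_cycleUnit (x : α) : ((cycleUnit hu x)⁻¹).val =
    (C ((-3 : ℤ) • edgeMatrix u (x, 2)) * X + C 1) *
      (C ((-3 : ℤ) • edgeMatrix u (x, 1)) * X + C 1) *
      (C ((-3 : ℤ) • edgeMatrix u (x, 0)) * X + C 1) := by
  simp only [cycleUnit, mul_inv_rev, Units.val_mul, val_inv_unipotentUnit, mul_assoc]

theorem natDegree_cycleLetter_le (x : α × Bool) : (cycleLetter hu x).val.natDegree ≤ 3 := by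
  obtain ⟨x, _ | _⟩ := x
  · rw [cycleLetter, cond_false, val_inv_cycleUnit]
    exact natDegree_mul_mul_le_three _ _ _
  · rw [cycleLetter, cond_true, val_cycleUnit]
    exact natDegree_mul_mul_le_three _ _ _

theorem coeff_cycleLetter (x : α × Bool) : (cycleLetter hu x).val.coeff 3 =
    shiftMatrix (fun p => (p.1 + 1, p.2)) (blockWeight u x) := by
  obtain ⟨x, _ | _⟩ := x
  · rw [cycleLetter, cond_false, val_inv_cycleUnit, coeff_three_mul_mul, smul_edgeMatrix_mul_neg]
  · rw [cycleLetter, cond_true, val_cycleUnit, coeff_three_mul_mul, smul_edgeMatrix_mul_pos]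

/-- The representation of the free group attached to a cyclic word. -/
noncomputable def cycleRep :
    FreeGroup α →* (Matrix (ZMod s × Fin 3) (ZMod s × Fin 3) ℤ)[X] :=
  (Units.coeHom _).comp (FreeGroup.lift (cycleUnit hu))

theorem cycleRep_mk (l : List (α × Bool)) :
    cycleRep hu (FreeGroup.mk l) = (l.map fun x => (cycleLetter hu x).val).prod := by
  rw [cycleRep, MonoidHom.comp_apply, FreeGroup.lift_mk, map_list_prod, List.map_map]
  rfl

theorem exists_cycleRep_eq (g : FreeGroup α) : ∃ b, cycleRep hu g = 1 + 3 * b := by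
  suffices h : FreeGroup.lift (cycleUnit hu) g ∈ unitsTrivialMod3 _ from h
  induction g using FreeGroup.induction_on with
  | C1 => rw [map_one]; exact one_mem _
  | of x =>
    rw [FreeGroup.lift_apply_of]
    exact mul_mem (mul_mem (unipotentUnit_mem _ _) (unipotentUnit_mem _ _)) (unipotentUnit_mem _ _)
  | inv_of x _ =>
    rw [map_inv, FreeGroup.lift_apply_of, cycleUnit, mul_inv_rev, mul_inv_rev]
    exact mul_mem (unipotentUnit_inv_mem _ _)
      (mul_mem (unipotentUnit_inv_mem _ _) (unipotentUnit_inv_mem _ _))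
  | mul x y hx hy => rw [map_mul]; exact mul_mem hx hy

theorem coeffTrace_cycleRep (l : List (α × Bool)) :
    coeffTrace _ (l.length * 3) (cycleRep hu (FreeGroup.mk l)) =
      ∑ p, if p = (fun p : ZMod s × Fin 3 => (p.1 + 1, p.2))^[l.length] p then
        pathWeight (fun p => (p.1 + 1, p.2)) (blockWeight u) l p else 0 := by
  have h := coeff_list_prod_of_natDegree_le (l.map fun x => (cycleLetter hu x).val) 3 (by
    simp only [List.mem_map]
    rintro _ ⟨x, -, rfl⟩
    exact natDegree_cycleLetter_le hu x)
  rw [List.length_map, List.map_map] at h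
  change Matrix.trace (Polynomial.coeff _ _) = _
  rw [cycleRep_mk, h, ← trace_shiftMatrix, ← shiftMatrix_list_prod]
  congr 3
  funext x
  exact coeff_cycleLetter hu x

theorem coeffTrace_cycleRep_eq_zero {l : List (α × Bool)} {m : ℕ} (hl : l.length * 3 < m) :
    coeffTrace _ m (cycleRep hu (FreeGroup.mk l)) = 0 := by
  change Matrix.trace (Polynomial.coeff _ _) = _
  rw [cycleRep_mk, coeff_eq_zero_of_natDegree_lt, Matrix.trace_zero]
  refine lt_of_le_of_lt ?_ hl
  clear hl
  induction l with
  | nil => simp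
  | cons x l ih =>
    rw [List.map_cons, List.prod_cons, List.length_cons, add_mul, add_comm, one_mul]
    exact natDegree_mul_le_of_le (natDegree_cycleLetter_le hu x) ih

theorem coeffTrace_cycleRep_ne_zero {w : List (α × Bool)} (hw : w.length = s)
    (hwu : ∀ i, (hi : i < w.length) → w[i] = u i) :
    coeffTrace _ (w.length * 3) (cycleRep hu (FreeGroup.mk w)) ≠ 0 := by
  let κ : α × Bool → ℤ := fun x => if x.2 then 27 else -27
  have hκ : (w.map κ).prod ≠ 0 := by
    rw [Ne, List.prod_eq_zero_iff, List.mem_map]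
    rintro ⟨⟨x, _ | _⟩, -, hx⟩ <;> simp [κ] at hx
  have hφ : ∀ x p, blockWeight u x p = 0 ∨ blockWeight u x p = κ x := by
    intro x p
    unfold blockWeight
    split_ifs <;> simp_all [κ]
  have h0 : pathWeight (fun p => (p.1 + 1, p.2)) (blockWeight u) w ((0, 0) : ZMod s × Fin 3) =
      (w.map κ).prod :=
    pathWeight_eq_prod fun i hi => by
      rw [iterate_block_shift, blockWeight, if_pos ⟨rfl, by rw [zero_add, hwu i hi]⟩]
  rw [coeffTrace_cycleRep]
  have hfix : ∀ p : ZMod s × Fin 3,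
      p = (fun p : ZMod s × Fin 3 => (p.1 + 1, p.2))^[w.length] p := by
    intro p
    rw [iterate_block_shift, hw, ZMod.natCast_self, add_zero]
  simp only [← hfix, if_true]
  have hsum : ∑ p, pathWeight (fun p => (p.1 + 1, p.2)) (blockWeight u) w p =
      (Finset.univ.filter fun p : ZMod s × Fin 3 =>
        pathWeight (fun p => (p.1 + 1, p.2)) (blockWeight u) w p ≠ 0).card * (w.map κ).prod := by
    rw [← Finset.sum_filter_ne_zero, Finset.sum_congr rfl fun p hp =>
      (pathWeight_eq_zero_or_prod hφ w p).resolve_left (Finset.mem_filter.1 hp).2,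
      Finset.sum_const, nsmul_eq_mul]
  rw [hsum]
  refine mul_ne_zero (Nat.cast_ne_zero.2 (Finset.card_ne_zero_of_mem
    (Finset.mem_filter.2 ⟨Finset.mem_univ (0, 0), ?_⟩))) hκ
  rwa [h0]

theorem exists_shift_of_coeffTrace_cycleRep_ne_zero {v : List (α × Bool)}
    (h : coeffTrace _ (v.length * 3) (cycleRep hu (FreeGroup.mk v)) ≠ 0) :
    ∃ j : ZMod s, ∀ i, (hi : i < v.length) → v[i] = u (j + i) := by
  rw [coeffTrace_cycleRep] at h
  obtain ⟨p, -, hp⟩ := Finset.exists_ne_zero_of_sum_ne_zero h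
  have hp := (ite_ne_right_iff.1 hp).2
  refine ⟨p.1, fun i hi => ?_⟩
  have hi' := apply_ne_zero_of_pathWeight_ne_zero hp i hi
  rw [iterate_block_shift] at hi'
  exact (ite_ne_right_iff.1 hi').1.2.symm

end CyclicWord

theorem FreeGroup.IsCyclicallyReduced.getElem_val_add_one {α : Type*} {w : List (α × Bool)}
    (hw : FreeGroup.IsCyclicallyReduced w) [NeZero w.length] (j : ZMod w.length)
    (h : (w[j.val]'(ZMod.val_lt j)).1 = (w[(j + 1).val]'(ZMod.val_lt _)).1) :
    (w[j.val]'(ZMod.val_lt j)).2 = (w[(j + 1).val]'(ZMod.val_lt _)).2 := by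
  have hj := ZMod.val_lt j
  have hval : (j + 1).val = (j.val + 1) % w.length := by
    rw [ZMod.val_add, ZMod.val_one_eq_one_mod, Nat.add_mod_mod]
  rcases lt_or_eq_of_le (Nat.succ_le_of_lt hj) with hlt | heq
  · have hval' : (j + 1).val = j.val + 1 := by rw [hval, Nat.mod_eq_of_lt hlt]
    simp only [hval'] at h ⊢
    exact List.isChain_iff_getElem.1 hw.1 _ hlt h
  · have hval' : (j + 1).val = 0 := by rw [hval, show j.val + 1 = w.length from heq, Nat.mod_self]
    have hj' : j.val = w.length - 1 := by omega
    simp only [hval', hj'] at h ⊢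
    refine hw.2 _ ?_ _ ?_ h
    · rw [List.getLast?_eq_getElem?, List.getElem?_eq_getElem]; rfl
    · rw [List.head?_eq_getElem?, List.getElem?_eq_getElem]; rfl

theorem FreeGroup.isConj_mk_rotate {α : Type*} (w : List (α × Bool)) {m : ℕ} (hm : m ≤ w.length) :
    IsConj (FreeGroup.mk (w.rotate m)) (FreeGroup.mk w) := by
  rw [List.rotate_eq_drop_append_take hm]
  nth_rewrite 3 [← List.take_append_drop m w]
  rw [← FreeGroup.mul_mk, ← FreeGroup.mul_mk, isConj_iff]
  exact ⟨FreeGroup.mk (w.take m), by group⟩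

theorem isConj_mk_of_integralTraces {α : Type*} {w v : List (α × Bool)}
    (hw : FreeGroup.IsCyclicallyReduced w) (hvw : v.length ≤ w.length)
    (h : ∀ L ∈ integralTraces (augmentationMod3 (groupRingAugmentation (FreeGroup α))),
      L (MonoidAlgebra.of ℤ _ (FreeGroup.mk v)) = L (MonoidAlgebra.of ℤ _ (FreeGroup.mk w))) :
    IsConj (FreeGroup.mk v) (FreeGroup.mk w) := by
  classical
  rcases eq_or_ne w.length 0 with h0 | h0
  · rw [List.eq_nil_of_length_eq_zero h0, List.eq_nil_of_length_eq_zero (by omega : v.length = 0)]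
  · have : NeZero w.length := ⟨h0⟩
    let u : ZMod w.length → α × Bool := fun j => w[j.val]'(ZMod.val_lt j)
    have hu : ∀ j, (u j).1 = (u (j + 1)).1 → (u j).2 = (u (j + 1)).2 :=
      hw.getElem_val_add_one
    have hL := h _ (comp_lift_mem_integralTraces (exists_cycleRep_eq hu)
      (coeffTrace_mul_comm (w.length * 3)))
    have hL' : coeffTrace _ (w.length * 3) (cycleRep hu (FreeGroup.mk v)) =
        coeffTrace _ (w.length * 3) (cycleRep hu (FreeGroup.mk w)) := by
      simpa using hL
    have hne := coeffTrace_cycleRep_ne_zero hu rfl fun i hi => by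
      simp only [u, ZMod.val_natCast, Nat.mod_eq_of_lt hi]
    rw [← hL'] at hne
    have hlen : v.length = w.length := by
      by_contra hlen
      exact hne (coeffTrace_cycleRep_eq_zero hu (by omega))
    rw [show w.length * 3 = v.length * 3 by rw [hlen]] at hne
    obtain ⟨j, hj⟩ := exists_shift_of_coeffTrace_cycleRep_ne_zero hu hne
    have hrot : v = w.rotate j.val := by
      refine List.ext_getElem (by rw [List.length_rotate, hlen]) fun i hi _ => ?_
      rw [hj i hi, List.getElem_rotate]
      simp only [u, ZMod.val_add, ZMod.val_natCast, Nat.add_mod_mod, add_comm i]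
    rw [hrot]
    exact FreeGroup.isConj_mk_rotate w (ZMod.val_lt j).le

theorem FreeGroup.exists_isCyclicallyReduced_isConj {α : Type*} (g : FreeGroup α) :
    ∃ w, FreeGroup.IsCyclicallyReduced w ∧ IsConj g (FreeGroup.mk w) := by
  classical
  refine ⟨FreeGroup.reduceCyclically g.toWord,
    FreeGroup.reduceCyclically.isCyclicallyReduced FreeGroup.isReduced_toWord, ?_⟩
  have h := FreeGroup.reduceCyclically.conj_conjugator_reduceCyclically g.toWord
  nth_rewrite 1 [← FreeGroup.mk_toWord (x := g), ← h]
  rw [← FreeGroup.mul_mk, ← FreeGroup.mul_mk, ← FreeGroup.inv_mk]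
  exact IsConj.symm (isConj_iff.2 ⟨_, rfl⟩)

/-- Conjugacy classes of a free group are separated by integral traces. -/
theorem FreeGroup.isConj_of_integralTraces {α : Type*} {g h : FreeGroup α}
    (hgh : ∀ L ∈ integralTraces (augmentationMod3 (groupRingAugmentation (FreeGroup α))),
      L (MonoidAlgebra.of ℤ _ g) = L (MonoidAlgebra.of ℤ _ h)) : IsConj g h := by
  obtain ⟨v, hv, hgv⟩ := g.exists_isCyclicallyReduced_isConj
  obtain ⟨w, hw, hhw⟩ := h.exists_isCyclicallyReduced_isConj
  have key : ∀ L ∈ integralTraces (augmentationMod3 (groupRingAugmentation (FreeGroup α))),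
      L (MonoidAlgebra.of ℤ _ (FreeGroup.mk v)) = L (MonoidAlgebra.of ℤ _ (FreeGroup.mk w)) :=
    fun L hL => by
      rw [← integralTraces_apply_of_isConj hgv L hL, hgh L hL,
        integralTraces_apply_of_isConj hhw L hL]
  refine hgv.trans (IsConj.trans ?_ hhw.symm)
  rcases le_total v.length w.length with hvw | hvw
  · exact isConj_mk_of_integralTraces hw hvw key
  · exact (isConj_mk_of_integralTraces hv hvw fun L hL => (key L hL).symm).symm

/-- Every periodic conjugacy class of an element of `IA_n(ℤ/3)` is fixed
(Theorem 4.1 of the paper, at the level of automorphism representatives). -/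
theorem periodic_conjClass_fixed {n : ℕ} (hn : 1 ≤ n)
    (Φ : FreeGroup (Fin n) ≃* FreeGroup (Fin n))
    (hΦ : ActsTriviallyOnH1Mod3 Φ)
    (c : FreeGroup (Fin n)) (k : ℕ) (hk : 1 ≤ k)
    (hper : IsConj ((Φ ^ k) c) c) :
    IsConj (Φ c) c := by
  exact FreeGroup.isConj_of_integralTraces
    (integralTraces_apply_of_eq hΦ (Nat.one_le_iff_ne_zero.1 hk) hper)
end

section
/- Let n ≥ 1, F := FreeGroup (Fin n), and let Φ : F ≃* F act trivially on H₁(F; ℤ/3). Let A : Fin k → Subgroup F and B ≤ F realize an internal free product decomposition of F representing a free factor system (each A i nontrivial, and the A i pairwise nonconjugate). Suppose there exists m ≥ 1 such that for every i there exist j and g ∈ F with Φ^m(A i) = g • (A j) • g⁻¹ (image of A i under Φ^m equals the conjugate of A j by g). Then for every i there exist j and h ∈ F with Φ(A i) = h • (A j) • h⁻¹. (Every ψ-periodic free factor system is ψ-invariant for ψ ∈ IA_n(ℤ/3); Theorem 'ThmPeriodicFreeFactor' of the paper.) -/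
/-- The conjugate subgroup `g • H • g⁻¹`. -/
def conjSubgroup {G : Type*} [Group G] (g : G) (H : Subgroup G) : Subgroup G :=
  Subgroup.map (MulEquiv.toMonoidHom (MulAut.conj g)) H

/-- The subgroups `A 0, …, A (k-1), B` realize an internal free product decomposition
of `G`: the homomorphism from the free product (`Monoid.CoprodI`) of these subgroups
to `G` induced by the inclusions is bijective. -/
def IsFreeProductDecomp {G : Type*} [Group G] {k : ℕ}
    (A : Fin k → Subgroup G) (B : Subgroup G) : Prop :=
  Function.Bijective
    (Monoid.CoprodI.lift (fun i : Option (Fin k) => (Option.elim i B A).subtype))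

open Filter Topology in
/-- A power series over `ℚ_[3]` with bounded coefficients that vanishes along a sequence of
nonzero points tending to zero is zero. -/
theorem padic_powerSeries_coeff_eq_zero {b : ℕ → ℚ_[3]} (C : ℝ) (hb : ∀ i, ‖b i‖ ≤ C)
    {x : ℕ → ℚ_[3]} (hx : Tendsto x atTop (𝓝 0)) (hx0 : ∀ e, x e ≠ 0)
    (hsum : ∀ e, HasSum (fun i => b i * x e ^ i) 0) : b = 0 := by
  set p := FormalMultilinearSeries.ofScalars ℚ_[3] b with hp
  have hr : ((1 : NNReal) : ENNReal) ≤ p.radius := by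
    refine p.le_radius_of_bound C fun n => ?_
    simpa [hp, FormalMultilinearSeries.ofScalars_norm] using hb n
  have hr0 : 0 < p.radius := lt_of_lt_of_le (by simp) hr
  have hps := p.hasFPowerSeriesOnBall hr0
  have hval : ∀ e, p.sum (x e) = 0 := by
    intro e
    rw [FormalMultilinearSeries.sum]
    have : (fun n => (p n) fun _ => x e) = fun i => b i * x e ^ i := by
      funext n
      simp [hp, FormalMultilinearSeries.ofScalars]
    rw [this]
    exact (hsum e).tsum_eq
  have han : AnalyticAt ℚ_[3] p.sum 0 := hps.analyticAt
  have hfreq : ∃ᶠ z in 𝓝[≠] (0 : ℚ_[3]), p.sum z = 0 := by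
    have ht : Tendsto x atTop (𝓝[≠] 0) :=
      tendsto_nhdsWithin_iff.2 ⟨hx, Eventually.of_forall hx0⟩
    exact ht.frequently (Eventually.of_forall hval).frequently
  have hev := han.frequently_zero_iff_eventually_zero.1 hfreq
  have h0 : HasFPowerSeriesAt (0 : ℚ_[3] → ℚ_[3]) p 0 := hps.hasFPowerSeriesAt.congr hev
  exact (FormalMultilinearSeries.ofScalars_series_eq_zero ℚ_[3]).1 h0.eq_zero

theorem padic_norm_div_factorial_le {a : ℤ} {j : ℕ} (ha : (3 : ℤ) ^ j ∣ a) :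
    ‖(a : ℚ_[3]) / (j.factorial : ℚ_[3])‖ ^ 2 ≤ (1 / 3 : ℝ) ^ j := by
  have h1 : ‖(a : ℚ_[3])‖ ≤ (3 : ℝ) ^ (-(j : ℤ)) := by
    have := (Padic.norm_int_le_pow_iff_dvd (p := 3) a j).2 (by exact_mod_cast ha)
    simpa using this
  have hv : 2 * padicValNat 3 j.factorial ≤ j := by
    have := sub_one_mul_padicValNat_factorial (p := 3) j
    omega
  have h2 : ‖(j.factorial : ℚ_[3])‖ = (3 : ℝ) ^ (-(padicValNat 3 j.factorial : ℤ)) := by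
    rw [Padic.norm_eq_zpow_neg_valuation (by exact_mod_cast j.factorial_ne_zero)]
    rw [Padic.valuation_natCast]
    norm_num
  have h1' : ‖(a : ℚ_[3])‖ ^ 2 ≤ ((3 : ℝ) ^ (-(j : ℤ))) ^ 2 := by gcongr
  rw [norm_div, div_pow, h2, div_le_iff₀ (by positivity)]
  refine h1'.trans ?_
  rw [one_div, inv_pow, ← zpow_natCast (3 : ℝ) j, ← zpow_neg, ← zpow_natCast, ← zpow_natCast,
    ← zpow_mul, ← zpow_mul, ← zpow_add₀ (by norm_num)]
  apply zpow_le_zpow_right₀ (by norm_num)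
  omega

theorem hasSum_comp_swap {α β γ : Type*} [AddCommMonoid α] [TopologicalSpace α] {f : β × γ → α}
    {a : α} (h : HasSum f a) : HasSum (fun q : γ × β => f q.swap) a :=
  (Equiv.prodComm γ β).hasSum_iff.2 h

open Filter Topology in
theorem summable_padic_triangular {u : ℕ → ℚ_[3]} (hu : Tendsto (fun j => ‖u j‖) atTop (𝓝 0))
    {c : ℕ → ℕ → ℤ} (hc : ∀ j i, j < i → c j i = 0) (k : ℕ) :
    Summable fun q : ℕ × ℕ => u q.2 * c q.2 q.1 * (k : ℚ_[3]) ^ q.1 := by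
  apply NonarchimedeanAddGroup.summable_of_tendsto_cofinite_zero
  rw [Metric.tendsto_nhds]
  intro ε hε
  rw [eventually_cofinite]
  obtain ⟨J, hJ⟩ := eventually_atTop.1 ((tendsto_order.1 hu).2 ε hε)
  refine ((Set.finite_Iio J).prod (Set.finite_Iio J)).subset ?_
  rintro ⟨i, j⟩ hij
  by_contra hn
  apply hij
  simp only [dist_zero_right]
  by_cases hji : j < i
  · simp [hc j i hji, hε]
  · have hjJ : J ≤ j := by
      by_contra hlt
      exact hn ⟨by simp; omega, by simp; omega⟩
    calc ‖u j * c j i * (k : ℚ_[3]) ^ i‖ = ‖u j‖ * ‖(c j i : ℚ_[3])‖ * ‖(k : ℚ_[3])‖ ^ i := by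
          simp
      _ ≤ ‖u j‖ * 1 * 1 ^ i := by
          gcongr
          · exact Padic.norm_int_le_one _
          · exact_mod_cast Padic.norm_int_le_one (p := 3) (k : ℤ)
      _ < ε := by simpa using hJ j hjJ

open Filter Topology in
/-- Interchange of summation for a triangular array: `∑ⱼ uⱼ ∑ᵢ cⱼᵢ kⁱ` is a power series in `k`. -/
theorem exists_padic_powerSeries_of_triangular {u : ℕ → ℚ_[3]}
    (hu : Tendsto (fun j => ‖u j‖) atTop (𝓝 0)) {c : ℕ → ℕ → ℤ} (hc : ∀ j i, j < i → c j i = 0) :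
    ∃ (b : ℕ → ℚ_[3]) (C : ℝ), (∀ i, ‖b i‖ ≤ C) ∧ ∀ (k : ℕ) (g : ℕ → ℚ_[3]) (t : ℚ_[3]),
      (∀ j, g j = ∑ i ∈ Finset.range (j + 1), u j * c j i * (k : ℚ_[3]) ^ i) → HasSum g t →
      HasSum (fun i => b i * (k : ℚ_[3]) ^ i) t := by
  have key := summable_padic_triangular hu hc
  have hb1 : ∀ i, Summable fun j => u j * (c j i : ℚ_[3]) := fun i => by
    simpa using (key 1).prod_factor i
  have hbs : Summable fun i => ∑' j, u j * (c j i : ℚ_[3]) := by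
    simpa using (key 1).prod
  obtain ⟨C, hC⟩ := (Metric.isBounded_range_of_tendsto _ hbs.tendsto_atTop_zero).exists_norm_le
  refine ⟨fun i => ∑' j, u j * c j i, C, fun i => hC _ ⟨i, rfl⟩, fun k g t hg ht => ?_⟩
  obtain ⟨t', ht'⟩ := key k
  have hrow : ∀ j, HasSum (fun i => u j * c j i * (k : ℚ_[3]) ^ i) (g j) := by
    intro j
    rw [hg j]
    refine hasSum_sum_of_ne_finset_zero fun i hi => ?_
    rw [hc j i (by simpa using hi)]
    simp
  have hsw : HasSum (fun q : ℕ × ℕ => u q.1 * c q.1 q.2 * (k : ℚ_[3]) ^ q.2) t' :=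
    hasSum_comp_swap ht'
  rw [ht.unique (hsw.prod_fiberwise hrow)]
  exact ht'.prod_fiberwise fun i => (hb1 i).hasSum.mul_right _

open Filter Topology in
/-- Integer sequences whose iterated differences at `0` are divisible by the powers of `3` are
given on the natural numbers by a convergent `3`-adic power series. -/
theorem exists_padic_powerSeries {s : ℕ → ℤ}
    (hs : ∀ j, (3 : ℤ) ^ j ∣ (fwdDiff 1)^[j] s 0) :
    ∃ (b : ℕ → ℚ_[3]) (C : ℝ), (∀ i, ‖b i‖ ≤ C) ∧
      ∀ k : ℕ, HasSum (fun i => b i * (k : ℚ_[3]) ^ i) (s k) := by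
  set u : ℕ → ℚ_[3] := fun j => ((fwdDiff 1)^[j] s 0 : ℤ) / (j.factorial : ℚ_[3]) with hu
  have hun : ∀ j, ‖u j‖ ^ 2 ≤ (1 / 3 : ℝ) ^ j := fun j => padic_norm_div_factorial_le (hs j)
  have hu0 : Tendsto (fun j => ‖u j‖) atTop (𝓝 0) := by
    have h2 : Tendsto (fun j => ‖u j‖ ^ 2) atTop (𝓝 0) :=
      squeeze_zero (fun j => by positivity) hun
        (tendsto_pow_atTop_nhds_zero_of_lt_one (by norm_num) (by norm_num))
    have h3 := (Real.continuous_sqrt.tendsto 0).comp h2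
    simpa [Function.comp_def, Real.sqrt_sq] using h3
  set c : ℕ → ℕ → ℤ := fun j i => (descPochhammer ℤ j).coeff i with hc
  have hc0 : ∀ j i, j < i → c j i = 0 := fun j i hji =>
    Polynomial.coeff_eq_zero_of_natDegree_lt (by rwa [descPochhammer_natDegree])
  obtain ⟨b, C, hC, hb⟩ := exists_padic_powerSeries_of_triangular hu0 hc0
  refine ⟨b, C, hC, fun k => hb k (fun j => (((fwdDiff 1)^[j] s 0 * k.choose j : ℤ) : ℚ_[3])) _
    (fun j => ?_) ?_⟩
  · have h1 : ∑ i ∈ Finset.range (j + 1), (c j i : ℚ_[3]) * (k : ℚ_[3]) ^ i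
        = (j.factorial : ℚ_[3]) * k.choose j := by
      have h2 := descPochhammer_eval_eq_descFactorial ℤ k j
      rw [Polynomial.eval_eq_sum_range, descPochhammer_natDegree,
        Nat.descFactorial_eq_factorial_mul_choose] at h2
      exact_mod_cast h2
    simp_rw [mul_assoc]
    rw [← Finset.mul_sum, h1, hu]
    have : (j.factorial : ℚ_[3]) ≠ 0 := by exact_mod_cast j.factorial_ne_zero
    field_simp
    push_cast
    ring
  · have h3 := shift_eq_sum_fwdDiff_iter 1 s k 0
    simp only [smul_eq_mul, mul_one, zero_add, nsmul_eq_mul] at h3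
    have h4 : (s k : ℚ_[3])
        = ∑ j ∈ Finset.range (k + 1), (((fwdDiff 1)^[j] s 0 * k.choose j : ℤ) : ℚ_[3]) := by
      rw [h3]
      push_cast
      exact Finset.sum_congr rfl fun _ _ => mul_comm _ _
    rw [h4]
    refine hasSum_sum_of_ne_finset_zero fun j hj => ?_
    rw [Nat.choose_eq_zero_of_lt (by simpa using hj)]
    simp

open Filter Topology in
theorem eq_zero_of_fwdDiff_dvd_of_periodic_zero {s : ℕ → ℤ}
    (hs : ∀ j, (3 : ℤ) ^ j ∣ (fwdDiff 1)^[j] s 0) {m : ℕ} (hm : 1 ≤ m)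
    (h0 : ∀ k, s (m * k) = 0) (k : ℕ) : s k = 0 := by
  obtain ⟨b, C, hC, hb⟩ := exists_padic_powerSeries hs
  have hx : Tendsto (fun e : ℕ => ((m * 3 ^ e : ℕ) : ℚ_[3])) atTop (𝓝 0) := by
    have h3 : Tendsto (fun e : ℕ => (3 : ℚ_[3]) ^ e) atTop (𝓝 0) :=
      tendsto_pow_atTop_nhds_zero_of_norm_lt_one (by
        have := Padic.norm_p_lt_one (p := 3)
        exact_mod_cast this)
    simpa using h3.const_mul (m : ℚ_[3])
  have hbz := padic_powerSeries_coeff_eq_zero C hC hx (fun e => by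
    have : m * 3 ^ e ≠ 0 := by positivity
    exact_mod_cast this) (fun e => by simpa [h0] using hb (m * 3 ^ e))
  have := hb k
  rw [hbz] at this
  have h := this.unique (a₂ := 0) (by simp)
  exact_mod_cast h

section GroupRing

variable {G : Type*} [Group G]

/-- The kernel of the mod `3` augmentation map of the integral group ring, as a `ℤ`-submodule. -/
noncomputable def modThreeAugmentation (G : Type*) [Group G] : Submodule ℤ (MonoidAlgebra ℤ G) :=
  Submodule.span ℤ (Set.range (fun g : G => MonoidAlgebra.of ℤ G g - 1) ∪ {3})

theorem of_sub_one_mem_modThreeAugmentation (g : G) :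
    MonoidAlgebra.of ℤ G g - 1 ∈ modThreeAugmentation G :=
  Submodule.subset_span (Or.inl ⟨g, rfl⟩)

theorem three_mem_modThreeAugmentation : (3 : MonoidAlgebra ℤ G) ∈ modThreeAugmentation G :=
  Submodule.subset_span (Or.inr rfl)

/-- The homomorphism `g ↦ g - 1` to the square-zero quotient. -/
noncomputable def augmentationHom (G : Type*) [Group G] :
    G →* Multiplicative (MonoidAlgebra ℤ G ⧸ (modThreeAugmentation G ^ 2)) where
  toFun g := Multiplicative.ofAdd (Submodule.Quotient.mk (MonoidAlgebra.of ℤ G g - 1))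
  map_one' := by rw [map_one, sub_self, Submodule.Quotient.mk_zero, ofAdd_zero]
  map_mul' g h := by
    rw [← ofAdd_add, ← Submodule.Quotient.mk_add]
    congr 1
    rw [Submodule.Quotient.eq, map_mul, pow_two]
    convert Submodule.mul_mem_mul (of_sub_one_mem_modThreeAugmentation g)
      (of_sub_one_mem_modThreeAugmentation h) using 1
    noncomm_ring

theorem augmentationHom_pow_three (g : G) : augmentationHom G g ^ 3 = 1 := by
  change Multiplicative.ofAdd (3 • (Submodule.Quotient.mk (MonoidAlgebra.of ℤ G g - 1) :
    MonoidAlgebra ℤ G ⧸ (modThreeAugmentation G ^ 2))) = 1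
  rw [← Submodule.Quotient.mk_smul, ofAdd_eq_one, Submodule.Quotient.mk_eq_zero, pow_two]
  convert Submodule.mul_mem_mul (three_mem_modThreeAugmentation (G := G))
    (of_sub_one_mem_modThreeAugmentation g) using 1
  simp [nsmul_eq_mul]

theorem of_map_sub_of_mem {Φ : G →* G}
    (hΦ : ∀ x, ∃ y : Abelianization G, Abelianization.of (Φ x) = Abelianization.of x * y ^ 3)
    (x : G) :
    MonoidAlgebra.of ℤ G (Φ x) - MonoidAlgebra.of ℤ G x ∈ modThreeAugmentation G ^ 2 := by
  obtain ⟨y, hy⟩ := hΦ x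
  obtain ⟨y, rfl⟩ := QuotientGroup.mk_surjective y
  change _ = _ * Abelianization.of y ^ 3 at hy
  have h := congrArg (Abelianization.lift (augmentationHom G)) hy
  rw [map_mul, map_pow, Abelianization.lift_apply_of, Abelianization.lift_apply_of,
    Abelianization.lift_apply_of, augmentationHom_pow_three, mul_one] at h
  have h' := (Submodule.Quotient.eq _).1 (Multiplicative.ofAdd.injective h)
  simpa using h'

/-- The endomorphism of the group ring induced by an endomorphism of the group. -/
noncomputable def groupRingMap (Φ : G →* G) : MonoidAlgebra ℤ G →ₐ[ℤ] MonoidAlgebra ℤ G :=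
  MonoidAlgebra.lift ℤ _ G ((MonoidAlgebra.of ℤ G).comp Φ)

theorem groupRingMap_of (Φ : G →* G) (g : G) :
    groupRingMap Φ (MonoidAlgebra.of ℤ G g) = MonoidAlgebra.of ℤ G (Φ g) := by
  simp [groupRingMap]

theorem groupRingMap_mem_pow (Φ : G →* G) (j : ℕ) {u : MonoidAlgebra ℤ G}
    (hu : u ∈ modThreeAugmentation G ^ j) : groupRingMap Φ u ∈ modThreeAugmentation G ^ j := by
  have h1 : (modThreeAugmentation G).map (groupRingMap Φ).toLinearMap ≤ modThreeAugmentation G := by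
    rw [modThreeAugmentation, Submodule.map_span_le]
    rintro _ (⟨g, rfl⟩ | rfl)
    · simp only [AlgHom.toLinearMap_apply, map_sub, map_one, groupRingMap_of]
      exact of_sub_one_mem_modThreeAugmentation _
    · rw [AlgHom.toLinearMap_apply, map_ofNat]
      exact three_mem_modThreeAugmentation
  have h2 := Submodule.map_pow (modThreeAugmentation G) (groupRingMap Φ) j
  have h3 : groupRingMap Φ u ∈ ((modThreeAugmentation G) ^ j).map (groupRingMap Φ).toLinearMap :=
    ⟨u, hu, rfl⟩
  rw [h2] at h3
  exact pow_le_pow_left' h1 j h3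

theorem groupRingMap_sub_mem_pow {Φ : G →* G}
    (hΦ : ∀ x, ∃ y : Abelianization G, Abelianization.of (Φ x) = Abelianization.of x * y ^ 3)
    (j : ℕ) {u : MonoidAlgebra ℤ G} (hu : u ∈ modThreeAugmentation G ^ (j + 1)) :
    groupRingMap Φ u - u ∈ modThreeAugmentation G ^ (j + 2) := by
  have base : ∀ u ∈ modThreeAugmentation G,
      groupRingMap Φ u - u ∈ modThreeAugmentation G ^ 2 := by
    intro u hu
    induction hu using Submodule.span_induction with
    | mem x hx =>
      rcases hx with ⟨g, rfl⟩ | rfl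
      · simpa only [map_sub, map_one, groupRingMap_of, sub_sub_sub_cancel_right]
          using of_map_sub_of_mem hΦ g
      · rw [map_ofNat, sub_self]
        exact zero_mem _
    | zero => simp
    | add x y _ _ hx hy => simpa only [map_add, add_sub_add_comm] using add_mem hx hy
    | smul c x _ hx => simpa only [map_smul, ← smul_sub] using Submodule.smul_mem _ c hx
  induction j generalizing u with
  | zero => exact base u (by simpa using hu)
  | succ j ih =>
    rw [pow_succ' _ (j + 1)] at hu
    refine Submodule.mul_induction_on hu (fun k hk v hv => ?_) (fun x y hx hy => ?_)
    · have h1 := Submodule.mul_mem_mul (base k hk) (groupRingMap_mem_pow Φ _ hv)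
      have h2 := Submodule.mul_mem_mul hk (ih hv)
      rw [← pow_add] at h1
      rw [← pow_succ'] at h2
      have e : 2 + (j + 1) = j + 1 + 2 := by ring
      rw [e] at h1
      convert add_mem h1 h2 using 1
      rw [map_mul]
      noncomm_ring
    · simpa only [map_add, add_sub_add_comm] using add_mem hx hy

theorem exists_lift_eq_three_pow_mul {R : Type*} [Ring R] {ρ : G →* R}
    (hρ : ∀ g, ∃ r, ρ g = 1 + 3 * r) (j : ℕ) {u : MonoidAlgebra ℤ G}
    (hu : u ∈ modThreeAugmentation G ^ j) :
    ∃ r, MonoidAlgebra.lift ℤ R G ρ u = 3 ^ j * r := by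
  induction hu using Submodule.pow_induction_on_left' with
  | algebraMap r => exact ⟨r, by simp⟩
  | add x y i _ _ hx hy =>
    obtain ⟨r, hr⟩ := hx
    obtain ⟨t, ht⟩ := hy
    exact ⟨r + t, by rw [map_add, hr, ht, mul_add]⟩
  | mem_mul k hk i x _ hx =>
    obtain ⟨r, hr⟩ := hx
    have : ∃ t, MonoidAlgebra.lift ℤ R G ρ k = 3 * t := by
      induction hk using Submodule.span_induction with
      | mem x hx =>
        rcases hx with ⟨g, rfl⟩ | rfl
        · obtain ⟨t, ht⟩ := hρ g
          exact ⟨t, by simp [ht]⟩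
        · exact ⟨1, by rw [map_ofNat, mul_one]⟩
      | zero => exact ⟨0, by simp⟩
      | add x y _ _ hx hy =>
        obtain ⟨r, hr⟩ := hx
        obtain ⟨t, ht⟩ := hy
        exact ⟨r + t, by rw [map_add, hr, ht, mul_add]⟩
      | smul c x _ hx =>
        obtain ⟨r, hr⟩ := hx
        exact ⟨c • r, by rw [map_smul, hr, mul_smul_comm]⟩
    obtain ⟨t, ht⟩ := this
    refine ⟨t * r, ?_⟩
    have hc : Commute ((3 : R) ^ i) t := (Nat.cast_commute 3 t).pow_left i
    rw [map_mul, hr, ht, pow_succ', mul_assoc, mul_assoc, ← mul_assoc t, ← hc.eq, mul_assoc]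

theorem fwdDiff_iter_comp_iterate {M N F : Type*} [AddCommGroup M] [AddCommGroup N]
    [FunLike F M N] [AddMonoidHomClass F M N] (l : F) (T : M →+ M) (j : ℕ) (v : M) :
    (fwdDiff 1)^[j] (fun k : ℕ => l (T^[k] v)) = fun k => l (T^[k] ((fun w => T w - w)^[j] v)) := by
  induction j generalizing v with
  | zero => rfl
  | succ j ih =>
    rw [Function.iterate_succ_apply, Function.iterate_succ_apply, ← ih]
    congr 1
    funext k
    rw [fwdDiff, Function.iterate_succ_apply, ← map_sub, ← iterate_map_sub]

theorem three_pow_dvd_fwdDiff_iter {R : Type*} [Ring R] {ρ : G →* R}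
    (hρ : ∀ g, ∃ r, ρ g = 1 + 3 * r) (τ : R →+ ℤ) {Φ : G →* G}
    (hΦ : ∀ x, ∃ y : Abelianization G, Abelianization.of (Φ x) = Abelianization.of x * y ^ 3)
    (a : G) (j : ℕ) :
    (3 : ℤ) ^ j ∣ (fwdDiff 1)^[j] (fun k : ℕ => τ (ρ (Φ^[k] a))) 0 := by
  set T : MonoidAlgebra ℤ G →+ MonoidAlgebra ℤ G :=
    (groupRingMap Φ).toLinearMap.toAddMonoidHom with hT
  set P : MonoidAlgebra ℤ G →+ ℤ :=
    τ.comp (MonoidAlgebra.lift ℤ R G ρ).toLinearMap.toAddMonoidHom with hP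
  have h1 : (fun k : ℕ => τ (ρ (Φ^[k] a))) = fun k => P (T^[k] (MonoidAlgebra.of ℤ G a)) := by
    funext k
    have : T^[k] (MonoidAlgebra.of ℤ G a) = MonoidAlgebra.of ℤ G (Φ^[k] a) := by
      induction k generalizing a with
      | zero => rfl
      | succ k ih =>
        rw [Function.iterate_succ_apply, Function.iterate_succ_apply, ← ih]
        congr 1
        exact groupRingMap_of Φ a
    rw [this, hP]
    simp
  rw [h1, fwdDiff_iter_comp_iterate]
  cases j with
  | zero => simp
  | succ j =>
    have h2 : ∀ j, (fun w => T w - w)^[j + 1] (MonoidAlgebra.of ℤ G a)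
        ∈ modThreeAugmentation G ^ (j + 2) := by
      intro j
      induction j with
      | zero =>
        have h := of_map_sub_of_mem hΦ a
        rw [← groupRingMap_of] at h
        exact h
      | succ j ih =>
        rw [Function.iterate_succ_apply']
        exact groupRingMap_sub_mem_pow hΦ _ ih
    obtain ⟨r, hr⟩ := exists_lift_eq_three_pow_mul hρ _ (h2 j)
    refine ⟨τ (3 * r), ?_⟩
    have h3 : P ((fun w => T w - w)^[j + 1] (MonoidAlgebra.of ℤ G a)) = τ (3 ^ (j + 2) * r) := by
      rw [← hr]; rfl
    change P ((fun w => T w - w)^[j + 1] (MonoidAlgebra.of ℤ G a)) = _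
    rw [h3, pow_succ (3 : R), mul_assoc]
    have h4 : (3 : R) ^ (j + 1) * (3 * r) = ((3 : ℤ) ^ (j + 1)) • (3 * r) := by
      rw [zsmul_eq_mul]; push_cast; rfl
    rw [h4, map_zsmul, smul_eq_mul]

end GroupRing

section Words

variable {G : Type*} [Group G] {ι : Type*} (b : FreeGroupBasis ι G)

/-- The element of a free group represented by a list of syllables `(i, e)`, standing for the
powers `b i ^ e`. -/
def syllableProd (L : List (ι × ℤ)) : G := (L.map fun p => b p.1 ^ p.2).prod

@[simp] theorem syllableProd_nil : syllableProd b [] = 1 := rfl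

@[simp] theorem syllableProd_cons (p : ι × ℤ) (L : List (ι × ℤ)) :
    syllableProd b (p :: L) = b p.1 ^ p.2 * syllableProd b L := by
  simp [syllableProd]

@[simp] theorem syllableProd_append (L M : List (ι × ℤ)) :
    syllableProd b (L ++ M) = syllableProd b L * syllableProd b M := by
  simp [syllableProd]

/-- The inverse of a list of syllables. -/
def syllableInv (L : List (ι × ℤ)) : List (ι × ℤ) := (L.map fun p => (p.1, -p.2)).reverse

theorem syllableProd_syllableInv (L : List (ι × ℤ)) :
    syllableProd b (syllableInv L) = (syllableProd b L)⁻¹ := by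
  induction L with
  | nil => simp [syllableInv]
  | cons p L ih =>
    simp only [syllableInv, List.map_cons, List.reverse_cons] at ih ⊢
    simp [ih]

theorem syllableProd_mem {S : Set ι} {L : List (ι × ℤ)} (hL : ∀ p ∈ L, p.1 ∈ S) :
    syllableProd b L ∈ Subgroup.closure (b '' S) := by
  refine Subgroup.list_prod_mem _ fun x hx => ?_
  obtain ⟨p, hp, rfl⟩ := List.mem_map.1 hx
  exact Subgroup.zpow_mem _ (Subgroup.subset_closure (Set.mem_image_of_mem _ (hL p hp))) _

theorem exists_syllableProd_eq {S : Set ι} {g : G} (hg : g ∈ Subgroup.closure (b '' S)) :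
    ∃ L : List (ι × ℤ), (∀ p ∈ L, p.1 ∈ S) ∧ syllableProd b L = g := by
  induction hg using Subgroup.closure_induction with
  | mem x hx =>
    obtain ⟨i, hi, rfl⟩ := hx
    exact ⟨[(i, 1)], by simpa using hi, by simp⟩
  | one => exact ⟨[], by simp, rfl⟩
  | mul x y _ _ hx hy =>
    obtain ⟨L, hL, rfl⟩ := hx
    obtain ⟨M, hM, rfl⟩ := hy
    refine ⟨L ++ M, fun p hp => ?_, by simp⟩
    rcases List.mem_append.1 hp with h | h
    exacts [hL p h, hM p h]
  | inv x _ hx =>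
    obtain ⟨L, hL, rfl⟩ := hx
    refine ⟨syllableInv L, fun p hp => ?_, syllableProd_syllableInv b L⟩
    simp only [syllableInv, List.mem_reverse, List.mem_map] at hp
    obtain ⟨q, hq, rfl⟩ := hp
    exact hL q hq

theorem FreeGroupBasis.closure_range_eq_top : Subgroup.closure (Set.range b) = ⊤ := by
  have h := congrArg (Subgroup.map b.repr.symm.toMonoidHom) (FreeGroup.closure_range_of ι)
  rw [MonoidHom.map_closure, ← Set.range_comp] at h
  rw [Subgroup.map_top_of_surjective _ b.repr.symm.surjective] at h
  exact h

theorem exists_syllableProd_eq' (g : G) : ∃ L : List (ι × ℤ), syllableProd b L = g := by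
  obtain ⟨L, -, hL⟩ := exists_syllableProd_eq b (S := Set.univ) (g := g)
    (by rw [Set.image_univ, b.closure_range_eq_top]; trivial)
  exact ⟨L, hL⟩

/-- A list of syllables is reduced if its exponents are nonzero and consecutive syllables belong
to distinct generators. -/
def IsReducedSyllables (L : List (ι × ℤ)) : Prop :=
  (∀ p ∈ L, p.2 ≠ 0) ∧ L.IsChain fun p q => p.1 ≠ q.1

/-- Among the syllable lists over `S` with product in `X`, one of minimal length is reduced. -/
theorem exists_minimal_syllables {S : Set ι} {X : Set G}
    (h : ∃ L : List (ι × ℤ), (∀ p ∈ L, p.1 ∈ S) ∧ syllableProd b L ∈ X) :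
    ∃ L : List (ι × ℤ), (∀ p ∈ L, p.1 ∈ S) ∧ syllableProd b L ∈ X ∧ IsReducedSyllables L ∧
      ∀ M : List (ι × ℤ), (∀ p ∈ M, p.1 ∈ S) → syllableProd b M ∈ X → L.length ≤ M.length := by
  obtain ⟨L, ⟨hS, hX⟩, hmin⟩ :=
    exists_minimalFor_of_wellFoundedLT (fun L : List (ι × ℤ) =>
      (∀ p ∈ L, p.1 ∈ S) ∧ syllableProd b L ∈ X) List.length h
  have hmin' : ∀ M : List (ι × ℤ), (∀ p ∈ M, p.1 ∈ S) → syllableProd b M ∈ X →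
      L.length ≤ M.length := fun M hM hMX => by
    by_contra hlt
    exact hlt (hmin ⟨hM, hMX⟩ (by omega))
  refine ⟨L, hS, hX, ⟨?_, ?_⟩, hmin'⟩
  · rintro ⟨i, e⟩ hp (rfl : e = 0)
    obtain ⟨L₁, L₂, rfl⟩ := List.append_of_mem hp
    have := hmin' (L₁ ++ L₂) (fun q hq => hS q (by simp at hq ⊢; tauto)) (by simpa using hX)
    simp at this
  · rw [List.isChain_iff_forall_rel_of_append_cons_cons]
    rintro ⟨i, e⟩ ⟨i', f⟩ L₁ L₂ rfl (rfl : i = i')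
    have := hmin' (L₁ ++ (i, e + f) :: L₂) (fun q hq => by
      simp only [List.mem_append, List.mem_cons] at hq
      rcases hq with h | rfl | h
      · exact hS q (by simp [h])
      · exact hS (i, e) (by simp)
      · exact hS q (by simp [h])) (by simpa [zpow_add, mul_assoc] using hX)
    simp at this

/-- A list of syllables whose first and last generators differ, when there are at least two
syllables. -/
def HasDistinctEnds (L : List (ι × ℤ)) : Prop :=
  ∀ (p q : ι × ℤ) (M : List (ι × ℤ)), L = p :: (M ++ [q]) → p.1 ≠ q.1

theorem exists_isConj_cyclicallyReduced (g : G) :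
    ∃ L : List (ι × ℤ), IsConj g (syllableProd b L) ∧ IsReducedSyllables L ∧
      HasDistinctEnds L := by
  obtain ⟨L₀, rfl⟩ := exists_syllableProd_eq' b g
  obtain ⟨L, -, hX, hred, hmin⟩ := exists_minimal_syllables b (S := Set.univ)
    (X := {x | IsConj (syllableProd b L₀) x}) ⟨L₀, by simp, IsConj.refl _⟩
  refine ⟨L, hX, hred, ?_⟩
  rintro ⟨i, e⟩ ⟨i', f⟩ M rfl (rfl : i = i')
  have h := hmin ((i, f + e) :: M) (by simp) (by
    refine IsConj.trans hX (isConj_iff.2 ⟨b i ^ f, ?_⟩)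
    simp [zpow_add, mul_assoc])
  simp at h

end Words

section Magnus

variable {R : Type*} [Ring R]

/-- The one-parameter group `e ↦ 1 + 3 e x` attached to an element `x` of square zero. -/
def squareZeroPowHom (x : R) (hx : x * x = 0) : Multiplicative ℤ →* R where
  toFun e := 1 + (3 * Multiplicative.toAdd e) • x
  map_one' := by simp
  map_mul' e f := by
    simp only [toAdd_mul, mul_add, add_mul, add_smul, one_mul, mul_one, smul_mul_assoc,
      mul_smul_comm, hx, smul_zero, add_zero]
    abel

variable {G : Type*} [Group G] {ι : Type*} (b : FreeGroupBasis ι G)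

/-- The Magnus type representation sending `b i` to `1 + 3 ν i`, for elements `ν i` of square
zero. -/
def magnus (ν : ι → R) (hν : ∀ i, ν i * ν i = 0) : G →* R :=
  (Units.coeHom R).comp
    (b.lift fun i => (squareZeroPowHom (ν i) (hν i)).toHomUnits (Multiplicative.ofAdd 1))

variable {ν : ι → R} (hν : ∀ i, ν i * ν i = 0)

theorem magnus_zpow (i : ι) (e : ℤ) : magnus b ν hν (b i ^ e) = 1 + (3 * e) • ν i := by
  have h : b.lift (fun i => (squareZeroPowHom (ν i) (hν i)).toHomUnits (Multiplicative.ofAdd 1))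
      (b i ^ e) = (squareZeroPowHom (ν i) (hν i)).toHomUnits (Multiplicative.ofAdd e) := by
    have he : Multiplicative.ofAdd e = Multiplicative.ofAdd (1 : ℤ) ^ e := by
      rw [← ofAdd_zsmul, smul_eq_mul, mul_one]
    rw [he, map_zpow, map_zpow]
    simp
  rw [magnus, MonoidHom.comp_apply, h]
  rfl

theorem magnus_syllableProd (L : List (ι × ℤ)) :
    magnus b ν hν (syllableProd b L) = (L.map fun p => 1 + (3 * p.2) • ν p.1).prod := by
  induction L with
  | nil => simp
  | cons p L ih => simp [ih, magnus_zpow]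

theorem magnus_mem {M : Submonoid R} {S : Set ι} (hM : ∀ i ∈ S, ∀ e : ℤ, 1 + (3 * e) • ν i ∈ M)
    {g : G} (hg : g ∈ Subgroup.closure (b '' S)) : magnus b ν hν g ∈ M := by
  obtain ⟨L, hL, rfl⟩ := exists_syllableProd_eq b hg
  rw [magnus_syllableProd]
  refine Submonoid.list_prod_mem _ fun x hx => ?_
  obtain ⟨p, hp, rfl⟩ := List.mem_map.1 hx
  exact hM _ (hL p hp) _

theorem magnus_eq_one_add_three_mul (g : G) : ∃ r, magnus b ν hν g = 1 + 3 * r := by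
  let M : Submonoid R :=
    { carrier := {x | ∃ r, x = 1 + 3 * r}
      one_mem' := ⟨0, by simp⟩
      mul_mem' := by
        rintro _ _ ⟨r, rfl⟩ ⟨s, rfl⟩
        refine ⟨r + s + r * (3 * s), ?_⟩
        simp only [mul_add, add_mul, one_mul, mul_one, mul_assoc]
        abel }
  have hM : magnus b ν hν g ∈ M := magnus_mem b hν (M := M) (S := Set.univ)
    (fun i _ e => show ∃ r, 1 + (3 * e) • ν i = 1 + 3 * r from
      ⟨e • ν i, by simp [mul_assoc]⟩)
    (by rw [Set.image_univ, b.closure_range_eq_top]; trivial)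
  exact hM

end Magnus

section CyclicWalk

variable {ι : Type*} {l : ℕ}

open Classical in
/-- The part of the adjacency matrix of an oriented `l`-cycle consisting of the edges with
label `i`. -/
noncomputable def cycleMatrix (c : ZMod l → ι) (i : ι) : Matrix (ZMod l) (ZMod l) ℤ :=
  fun s u => if u = s + 1 ∧ c s = i then 1 else 0

variable [NeZero l] {c : ZMod l → ι}

theorem cycleMatrix_mul_self (hc : ∀ s, c s ≠ c (s + 1)) (i : ι) :
    cycleMatrix c i * cycleMatrix c i = 0 := by
  ext s u
  rw [Matrix.mul_apply]
  refine Finset.sum_eq_zero fun v _ => ?_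
  by_contra h
  obtain ⟨h₁, h₂⟩ := mul_ne_zero_iff.1 h
  simp only [cycleMatrix, ne_eq, ite_eq_right_iff, one_ne_zero, imp_false, not_not] at h₁ h₂
  exact hc s (by rw [h₁.2, ← h₁.1, h₂.2])

theorem cycleMatrix_prod_nonneg (M : List ι) (s u : ZMod l) :
    0 ≤ (M.map (cycleMatrix c)).prod s u := by
  induction M generalizing s with
  | nil =>
    rw [List.map_nil, List.prod_nil, Matrix.one_apply]
    positivity
  | cons i M ih =>
    rw [List.map_cons, List.prod_cons, Matrix.mul_apply]
    refine Finset.sum_nonneg fun v _ => mul_nonneg ?_ (ih v)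
    unfold cycleMatrix
    positivity

theorem cycleMatrix_prod_apply (M : List ι) (s : ZMod l)
    (hM : ∀ (t : ℕ) (ht : t < M.length), M[t] = c (s + t)) :
    (M.map (cycleMatrix c)).prod s (s + M.length) = 1 := by
  induction M generalizing s with
  | nil => simp
  | cons i M ih =>
    have h0 : i = c s := (hM 0 (by simp)).trans (by simp)
    rw [List.map_cons, List.prod_cons, Matrix.mul_apply, Finset.sum_eq_single (s + 1)]
    · have := ih (s + 1) fun t ht => by
        have := hM (t + 1) (by simpa using ht)
        simpa [add_assoc, add_comm (1 : ZMod l)] using this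
      rw [List.length_cons, Nat.cast_add, Nat.cast_one, add_comm (M.length : ZMod l) 1,
        ← add_assoc, this]
      simp [cycleMatrix, h0]
    · intro v _ hv
      simp [cycleMatrix, hv]
    · simp

theorem cycleMatrix_prod_trace_ne_zero (M : List ι) (hl : M.length = l)
    (hM : ∀ (t : ℕ) (ht : t < M.length), M[t] = c t) :
    (M.map (cycleMatrix c)).prod.trace ≠ 0 := by
  have h1 := cycleMatrix_prod_apply (c := c) M 0 (by simpa using hM)
  rw [hl, ZMod.natCast_self, add_zero] at h1
  have h2 := Finset.single_le_sum (f := fun s => (M.map (cycleMatrix c)).prod s s)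
    (fun s _ => cycleMatrix_prod_nonneg M s s) (Finset.mem_univ 0)
  simp only [h1] at h2
  rw [Matrix.trace]
  simp only [Matrix.diag_apply]
  omega

open Polynomial

/-- Trace of the coefficient of degree `l`. -/
noncomputable def traceCoeff (l : ℕ) [NeZero l] : (Matrix (ZMod l) (ZMod l) ℤ)[X] →+ ℤ where
  toFun p := (p.coeff l).trace
  map_zero' := by simp
  map_add' p q := by simp

theorem traceCoeff_mul_comm (p q : (Matrix (ZMod l) (ZMod l) ℤ)[X]) :
    traceCoeff l (p * q) = traceCoeff l (q * p) := by
  simp only [traceCoeff, AddMonoidHom.coe_mk, ZeroHom.coe_mk, coeff_mul, Matrix.trace_sum]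
  rw [← Finset.Nat.sum_antidiagonal_swap]
  exact Finset.sum_congr rfl fun x _ => Matrix.trace_mul_comm _ _

/-- The polynomials whose degree `d` coefficients are supported on walks of length `d` around the
cycle with labels in `S`. -/
def walkSubmonoid (c : ZMod l → ι) (S : Set ι) :
    Submonoid (Matrix (ZMod l) (ZMod l) ℤ)[X] where
  carrier := {p | ∀ (d : ℕ) (s u : ZMod l), p.coeff d s u ≠ 0 →
    u = s + d ∧ ∀ t : ℕ, t < d → c (s + t) ∈ S}
  one_mem' := by
    intro d s u h
    rw [coeff_one] at h
    split_ifs at h with hd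
    · subst hd
      rw [Matrix.one_apply] at h
      split_ifs at h with hs
      · simp [hs]
      · simp at h
    · simp at h
  mul_mem' := by
    intro p q hp hq d s u h
    rw [coeff_mul, Matrix.sum_apply] at h
    obtain ⟨x, hx, h⟩ := Finset.exists_ne_zero_of_sum_ne_zero h
    rw [Finset.HasAntidiagonal.mem_antidiagonal] at hx
    rw [Matrix.mul_apply] at h
    obtain ⟨v, -, h⟩ := Finset.exists_ne_zero_of_sum_ne_zero h
    obtain ⟨h₁, h₂⟩ := mul_ne_zero_iff.1 h
    obtain ⟨hv, hp⟩ := hp _ _ _ h₁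
    obtain ⟨hu, hq⟩ := hq _ _ _ h₂
    refine ⟨by rw [hu, hv, ← hx]; push_cast; ring, fun t ht => ?_⟩
    rcases lt_or_ge t x.1 with h | h
    · exact hp t h
    · have := hq (t - x.1) (by omega)
      rwa [hv, Nat.cast_sub h, add_assoc, add_sub_cancel] at this

theorem one_add_smul_monomial_mem_walkSubmonoid {S : Set ι} {i : ι} (hi : i ∈ S) (e : ℤ) :
    1 + e • monomial 1 (cycleMatrix c i) ∈ walkSubmonoid c S := by
  intro d s u h
  match d with
  | 0 =>
    have : (1 : Matrix (ZMod l) (ZMod l) ℤ) s u ≠ 0 := by simpa using h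
    rw [Matrix.one_apply] at this
    simp only [ne_eq, ite_eq_right_iff, one_ne_zero, imp_false, not_not] at this
    simp [this]
  | 1 =>
    have : e ≠ 0 ∧ cycleMatrix c i s u ≠ 0 := by
      simpa [coeff_one, -zsmul_eq_mul] using h
    have := this.2
    simp only [cycleMatrix, ne_eq, ite_eq_right_iff, one_ne_zero, imp_false, not_not] at this
    refine ⟨by simpa using this.1, fun t ht => ?_⟩
    obtain rfl : t = 0 := by omega
    simpa [this.2] using hi
  | d + 2 => simp [coeff_one, coeff_monomial] at h

theorem traceCoeff_eq_zero {S : Set ι} (hS : ∃ s, c s ∉ S) {p : (Matrix (ZMod l) (ZMod l) ℤ)[X]}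
    (hp : p ∈ walkSubmonoid c S) : traceCoeff l p = 0 := by
  obtain ⟨x, hx⟩ := hS
  refine Finset.sum_eq_zero fun s _ => ?_
  by_contra h
  refine hx ?_
  have := (hp l s s h).2 (x - s).val (ZMod.val_lt _)
  rwa [ZMod.natCast_zmod_val, add_sub_cancel] at this

theorem prod_map_smul_eq {R : Type*} [Ring R] (N : ι → R) (L : List (ι × ℤ)) :
    (L.map fun p => (3 * p.2) • N p.1).prod =
      (L.map fun p => 3 * p.2).prod • ((L.map Prod.fst).map N).prod := by
  induction L with
  | nil => simp
  | cons p L ih => simp only [List.map_cons, List.prod_cons, ih, smul_mul_smul_comm]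

theorem traceCoeff_prod_ne_zero (L : List (ι × ℤ)) (hl : L.length = l) (h0 : ∀ p ∈ L, p.2 ≠ 0)
    (hL : ∀ (t : ℕ) (ht : t < L.length), L[t].1 = c t) :
    traceCoeff l (L.map fun p => 1 + (3 * p.2) • monomial 1 (cycleMatrix c p.1)).prod ≠ 0 := by
  have hcoeff := coeff_list_prod_of_natDegree_le
    (L.map fun p => 1 + (3 * p.2) • monomial 1 (cycleMatrix c p.1)) 1 (fun q hq => by
      obtain ⟨p, -, rfl⟩ := List.mem_map.1 hq
      refine natDegree_add_le_of_degree_le (by simp) ?_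
      exact (natDegree_smul_le _ _).trans (natDegree_monomial_le _))
  rw [List.length_map, hl, mul_one, List.map_map] at hcoeff
  have hfun : ((fun q : (Matrix (ZMod l) (ZMod l) ℤ)[X] => q.coeff 1) ∘
      fun p : ι × ℤ => 1 + (3 * p.2) • monomial 1 (cycleMatrix c p.1)) =
      fun p => (3 * p.2) • cycleMatrix c p.1 := by
    ext p : 1
    simp [coeff_one, -zsmul_eq_mul]
  rw [hfun, prod_map_smul_eq] at hcoeff
  change Matrix.trace (coeff _ l) ≠ 0
  rw [hcoeff, Matrix.trace_smul]
  refine smul_ne_zero ?_ (cycleMatrix_prod_trace_ne_zero _ (by simpa using hl) ?_)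
  · rw [Ne, List.prod_eq_zero_iff]
    intro h
    obtain ⟨p, hp, h⟩ := List.mem_map.1 h
    exact h0 p hp (by omega)
  · intro t ht
    simpa using hL t (by simpa using ht)

end CyclicWalk

section Detection

open Polynomial

variable {G : Type*} [Group G]

/-- A linear representation congruent to the identity modulo `3` together with a trace that
vanishes on the subgroup `A` but not at `g`. -/
def DetectedByTrace (A : Subgroup G) (g : G) : Prop :=
  ∃ (R : Type) (_ : Ring R) (ρ : G →* R) (τ : R →+ ℤ), (∀ x, ∃ r, ρ x = 1 + 3 * r) ∧
    (∀ x y, τ (x * y) = τ (y * x)) ∧ (∀ a ∈ A, τ (ρ a) = 0) ∧ τ (ρ g) ≠ 0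

theorem trace_conj {R : Type*} [Ring R] (ρ : G →* R) {τ : R →+ ℤ}
    (hτ : ∀ x y, τ (x * y) = τ (y * x)) {g g' : G} (h : IsConj g g') : τ (ρ g) = τ (ρ g') := by
  obtain ⟨c, rfl⟩ := isConj_iff.1 h
  rw [map_mul, hτ, ← map_mul]
  simp [← mul_assoc]

theorem DetectedByTrace.not_isConj {A : Subgroup G} {g a : G} (h : DetectedByTrace A g)
    (ha : a ∈ A) : ¬ IsConj g a := by
  obtain ⟨R, _, ρ, τ, -, hτ, hA, hg⟩ := h
  intro hc
  exact hg ((trace_conj ρ hτ hc).trans (hA a ha))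

theorem DetectedByTrace.of_isConj {A : Subgroup G} {g g' : G} (h : DetectedByTrace A g')
    (hc : IsConj g g') : DetectedByTrace A g := by
  obtain ⟨R, _, ρ, τ, h3, hτ, hA, hg⟩ := h
  exact ⟨R, _, ρ, τ, h3, hτ, hA, by rwa [trace_conj ρ hτ hc]⟩

variable {ι : Type*} (b : FreeGroupBasis ι G) {S : Set ι}

theorem detectedByTrace_of_single {i : ι} (hi : i ∉ S) {e : ℤ} (he : e ≠ 0) :
    DetectedByTrace (Subgroup.closure (b '' S)) (b i ^ e) := by
  classical
  let ν : ι → DualNumber ℤ := fun j => if j = i then DualNumber.eps else 0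
  have hν : ∀ j, ν j * ν j = 0 := fun j => by
    dsimp only [ν]
    split_ifs <;> simp
  let τ : DualNumber ℤ →+ ℤ := (TrivSqZeroExt.sndHom ℤ ℤ).toAddMonoidHom
  refine ⟨DualNumber ℤ, inferInstance, magnus b ν hν, τ, magnus_eq_one_add_three_mul b hν,
    fun x y => by rw [mul_comm], fun a ha => ?_, ?_⟩
  · have h : magnus b ν hν a ∈ (⊥ : Submonoid (DualNumber ℤ)) := magnus_mem b hν (fun j hj e => by
      have : j ≠ i := fun h => hi (h ▸ hj)
      simp [ν, this]) ha
    rw [Submonoid.mem_bot.1 h]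
    simp [τ]
  · rw [magnus_zpow]
    simp [τ, ν, he, -zsmul_eq_mul]

theorem HasDistinctEnds.getElem_ne {L : List (ι × ℤ)} (hL : HasDistinctEnds L)
    (hlen : 2 ≤ L.length) : L[L.length - 1].1 ≠ L[0].1 := by
  match L, hlen with
  | p :: q :: L, _ =>
    have hne : q :: L ≠ [] := by simp
    have := hL p ((q :: L).getLast hne) (q :: L).dropLast (by rw [List.dropLast_append_getLast])
    rw [← List.getLast_eq_getElem (by simp)]
    simpa using this.symm

theorem detectedByTrace_of_two_le_length {L : List (ι × ℤ)} (hlen : 2 ≤ L.length)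
    (hL : IsReducedSyllables L) (hends : HasDistinctEnds L) (hS : ∃ p ∈ L, p.1 ∉ S) :
    DetectedByTrace (Subgroup.closure (b '' S)) (syllableProd b L) := by
  obtain ⟨h0, hchain⟩ := hL
  obtain ⟨r, hr, hrS⟩ := hS
  have : NeZero L.length := ⟨by omega⟩
  let c : ZMod L.length → ι := fun s => (L[s.val]'(ZMod.val_lt s)).1
  have hcL : ∀ (t : ℕ) (ht : t < L.length), L[t].1 = c t := fun t ht => by
    simp [c, ZMod.val_natCast, Nat.mod_eq_of_lt ht]
  have hc : ∀ s, c s ≠ c (s + 1) := by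
    intro s
    have hs : s = (s.val : ℕ) := (ZMod.natCast_zmod_val s).symm
    have hlt := ZMod.val_lt s
    generalize s.val = t at hs hlt
    subst hs
    rw [← hcL t hlt]
    rcases eq_or_lt_of_le (Nat.succ_le_of_lt hlt) with h | h
    · have h1 : ((t : ZMod L.length) + 1) = (0 : ℕ) := by
        rw [← Nat.cast_one, ← Nat.cast_add, ← Nat.succ_eq_add_one, h]
        simp
      rw [h1, ← hcL 0 (by omega)]
      have h2 : t = L.length - 1 := by omega
      subst h2
      exact hends.getElem_ne hlen
    · rw [← Nat.cast_succ, ← hcL _ h]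
      exact List.isChain_iff_getElem.1 hchain t (by omega)
  have hν : ∀ i, (monomial 1 (cycleMatrix c i)) * (monomial 1 (cycleMatrix c i)) = 0 := fun i => by
    rw [monomial_mul_monomial, cycleMatrix_mul_self hc, monomial_zero_right]
  refine ⟨_, inferInstance, magnus b (fun i => monomial 1 (cycleMatrix c i)) hν,
    traceCoeff L.length, magnus_eq_one_add_three_mul b hν, traceCoeff_mul_comm, fun a ha => ?_,
    ?_⟩
  · refine traceCoeff_eq_zero (c := c) (S := S) ?_ (magnus_mem b hν
      (fun i hi e => one_add_smul_monomial_mem_walkSubmonoid hi _) ha)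
    obtain ⟨t, ht, rfl⟩ := List.getElem_of_mem hr
    exact ⟨t, by rwa [← hcL t ht]⟩
  · rw [magnus_syllableProd]
    exact traceCoeff_prod_ne_zero L rfl h0 hcL

theorem detectedByTrace_syllableProd {L : List (ι × ℤ)} (hL : IsReducedSyllables L)
    (hends : HasDistinctEnds L) (hS : ∃ p ∈ L, p.1 ∉ S) :
    DetectedByTrace (Subgroup.closure (b '' S)) (syllableProd b L) := by
  match L, hS with
  | [p], hS =>
    simp only [List.mem_singleton, exists_eq_left] at hS
    simpa using detectedByTrace_of_single b hS (hL.1 p (by simp))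
  | p :: q :: L, hS => exact detectedByTrace_of_two_le_length b (by simp) hL hends hS

theorem exists_isConj_mem_or_detectedByTrace (g : G) :
    (∃ a ∈ Subgroup.closure (b '' S), IsConj g a) ∨
      DetectedByTrace (Subgroup.closure (b '' S)) g := by
  obtain ⟨L, hconj, hred, hends⟩ := exists_isConj_cyclicallyReduced b g
  by_cases hS : ∃ p ∈ L, p.1 ∉ S
  · exact Or.inr ((detectedByTrace_syllableProd b hred hends hS).of_isConj hconj)
  · push Not at hS
    exact Or.inl ⟨_, syllableProd_mem b hS, hconj⟩

end Detection

section ConjugateIntoFactor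

variable {G : Type*} [Group G] {ι : Type*} (b : FreeGroupBasis ι G) {S : Set ι}

theorem exists_reduced_syllables_of_mem_closure {a : G} (ha : a ∈ Subgroup.closure (b '' S))
    (ha1 : a ≠ 1) : ∃ L : List (ι × ℤ), (∀ p ∈ L, p.1 ∈ S) ∧ syllableProd b L = a ∧
      IsReducedSyllables L ∧ L ≠ [] := by
  obtain ⟨L₀, h₀, rfl⟩ := exists_syllableProd_eq b ha
  obtain ⟨L, hL, hprod, hred, -⟩ := exists_minimal_syllables b (S := S) (X := {syllableProd b L₀})
    ⟨L₀, h₀, rfl⟩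
  refine ⟨L, hL, hprod, hred, ?_⟩
  rintro rfl
  exact ha1 hprod.symm

/-- Every double coset of a free factor other than the factor itself contains a reduced word
neither starting nor ending in the factor. -/
theorem exists_reduced_syllables_doubleCoset {u : G} (hu : u ∉ Subgroup.closure (b '' S)) :
    ∃ p ∈ Subgroup.closure (b '' S), ∃ q ∈ Subgroup.closure (b '' S), ∃ L : List (ι × ℤ),
      syllableProd b L = p * u * q ∧ IsReducedSyllables L ∧ L ≠ [] ∧
      (∀ x ∈ L.head?, x.1 ∉ S) ∧ ∀ x ∈ L.getLast?, x.1 ∉ S := by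
  set A := Subgroup.closure (b '' S) with hA
  have hgen : ∀ x : ι × ℤ, x.1 ∈ S → b x.1 ^ x.2 ∈ A := fun x hx =>
    Subgroup.zpow_mem _ (Subgroup.subset_closure (Set.mem_image_of_mem _ hx)) _
  obtain ⟨L₀, h₀⟩ := exists_syllableProd_eq' b u
  obtain ⟨L, -, ⟨p, hp, q, hq, h⟩, hred, hmin⟩ := exists_minimal_syllables b (S := Set.univ)
    (X := {x | ∃ p ∈ A, ∃ q ∈ A, x = p * u * q})
    ⟨L₀, by simp, 1, one_mem _, 1, one_mem _, by simpa using h₀⟩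
  refine ⟨p, hp, q, hq, L, h, hred, ?_, ?_, ?_⟩
  · rintro rfl
    rw [syllableProd_nil] at h
    have : u = p⁻¹ * q⁻¹ := by
      rw [eq_inv_mul_iff_mul_eq, eq_inv_iff_mul_eq_one, ← h]
    exact hu (this ▸ mul_mem (inv_mem hp) (inv_mem hq))
  · intro x hx hxS
    obtain ⟨M, rfl⟩ := List.head?_eq_some_iff.1 hx
    have := hmin M (by simp) ⟨(b x.1 ^ x.2)⁻¹ * p, mul_mem (inv_mem (hgen x hxS)) hp, q, hq, by
      rw [mul_assoc, mul_assoc, ← mul_assoc p, ← h]; simp⟩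
    simp at this
  · intro x hx hxS
    obtain ⟨M, rfl⟩ := List.getLast?_eq_some_iff.1 hx
    have := hmin M (by simp) ⟨p, hp, q * (b x.1 ^ x.2)⁻¹, mul_mem hq (inv_mem (hgen x hxS)), by
      rw [← mul_assoc, ← h]; simp⟩
    simp at this

theorem IsReducedSyllables.append {L M : List (ι × ℤ)} (hL : IsReducedSyllables L)
    (hM : IsReducedSyllables M) (h : ∀ x ∈ L.getLast?, ∀ y ∈ M.head?, x.1 ≠ y.1) :
    IsReducedSyllables (L ++ M) := by
  refine ⟨fun p hp => ?_, List.isChain_append.2 ⟨hL.2, hM.2, h⟩⟩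
  rcases List.mem_append.1 hp with hp | hp
  exacts [hL.1 p hp, hM.1 p hp]

theorem IsReducedSyllables.syllableInv {L : List (ι × ℤ)} (hL : IsReducedSyllables L) :
    IsReducedSyllables (syllableInv L) := by
  refine ⟨fun p hp => ?_, ?_⟩
  · simp only [_root_.syllableInv, List.mem_reverse, List.mem_map] at hp
    obtain ⟨q, hq, rfl⟩ := hp
    simpa using hL.1 q hq
  · rw [_root_.syllableInv, List.isChain_reverse, List.isChain_map]
    exact hL.2.imp fun _ _ h => h.symm

theorem detectedByTrace_mul_conj {a c u : G} (ha : a ∈ Subgroup.closure (b '' S)) (ha1 : a ≠ 1)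
    (hc : c ∈ Subgroup.closure (b '' S)) (hc1 : c ≠ 1) (hu : u ∉ Subgroup.closure (b '' S)) :
    DetectedByTrace (Subgroup.closure (b '' S)) (a * (u * c * u⁻¹)) := by
  obtain ⟨p, hp, q, hq, L, hL, hLred, hL0, hhead, hlast⟩ :=
    exists_reduced_syllables_doubleCoset b hu
  obtain ⟨La, haS, haL, hared, ha0⟩ := exists_reduced_syllables_of_mem_closure b
    (a := p * a * p⁻¹) (mul_mem (mul_mem hp ha) (inv_mem hp)) (by simpa using ha1)
  obtain ⟨Lc, hcS, hcL, hcred, hc0⟩ := exists_reduced_syllables_of_mem_closure b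
    (a := q⁻¹ * c * q) (mul_mem (mul_mem (inv_mem hq) hc) hq)
    (by simpa using (conj_eq_one_iff (a := q⁻¹) (b := c)).not.2 hc1)
  have hheadInv : ∀ x ∈ (syllableInv L).head?, x.1 ∉ S := by
    intro x hx
    simp only [syllableInv, List.head?_reverse, List.getLast?_map, Option.mem_def,
      Option.map_eq_some_iff] at hx
    obtain ⟨y, hy, rfl⟩ := hx
    exact hlast y hy
  have hlastInv : ∀ x ∈ (syllableInv L).getLast?, x.1 ∉ S := by
    intro x hx
    simp only [syllableInv, List.getLast?_reverse, List.head?_map, Option.mem_def,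
      Option.map_eq_some_iff] at hx
    obtain ⟨y, hy, rfl⟩ := hx
    exact hhead y hy
  have hI0 : syllableInv L ≠ [] := by simpa [syllableInv] using hL0
  have hconj : IsConj (a * (u * c * u⁻¹)) (syllableProd b ((La ++ L) ++ (Lc ++ syllableInv L))) := by
    refine isConj_iff.2 ⟨p, ?_⟩
    simp only [syllableProd_append, syllableProd_syllableInv, hL, haL, hcL]
    group
  refine (detectedByTrace_syllableProd b ?_ ?_ ?_).of_isConj hconj
  · refine (hared.append hLred ?_).append (hcred.append hLred.syllableInv ?_) ?_
    · intro x hx y hy h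
      exact hhead y hy (h ▸ haS x (List.mem_of_getLast? hx))
    · intro x hx y hy h
      exact hheadInv y hy (h ▸ hcS x (List.mem_of_getLast? hx))
    · intro x hx y hy h
      rw [List.getLast?_append_of_ne_nil _ hL0] at hx
      rw [List.head?_append_of_ne_nil _ hc0] at hy
      exact hlast x hx (h ▸ hcS y (List.mem_of_head? hy))
  · intro x y M hW h
    have hx := congrArg List.head? hW
    have hy := congrArg List.getLast? hW
    rw [List.append_assoc, List.head?_append_of_ne_nil _ ha0] at hx
    rw [← List.append_assoc, List.getLast?_append_of_ne_nil _ hI0, ← List.cons_append,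
      List.getLast?_concat] at hy
    exact hlastInv y hy (h ▸ haS x (List.mem_of_head? hx))
  · obtain ⟨x, M, rfl⟩ := List.exists_cons_of_ne_nil hL0
    exact ⟨x, by simp, hhead x rfl⟩

/-- A subgroup all of whose elements are conjugate into a free factor is itself conjugate into
that free factor. -/
theorem exists_conj_le_of_forall_isConj {K : Subgroup G}
    (hK : ∀ x ∈ K, ∃ a ∈ Subgroup.closure (b '' S), IsConj x a) :
    ∃ h : G, ∀ x ∈ K, h * x * h⁻¹ ∈ Subgroup.closure (b '' S) := by
  by_cases hbot : K = ⊥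
  · subst hbot
    exact ⟨1, fun x hx => by simp [Subgroup.mem_bot.1 hx]⟩
  obtain ⟨x, hx, hx1⟩ := K.bot_or_exists_ne_one.resolve_left hbot
  obtain ⟨a, ha, hxa⟩ := hK x hx
  obtain ⟨h, rfl⟩ := isConj_iff.1 hxa
  refine ⟨h, fun y hy => ?_⟩
  by_contra hyA
  obtain ⟨c, hc, hyc⟩ := hK y hy
  obtain ⟨v, rfl⟩ := isConj_iff.1 hyc
  have hu : h * v⁻¹ ∉ Subgroup.closure (b '' S) := by
    intro hu
    refine hyA ?_
    convert mul_mem (mul_mem hu hc) (inv_mem hu) using 1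
    group
  have hy1 : y ≠ 1 := by
    rintro rfl
    simp at hyA
  have hdet := detectedByTrace_mul_conj b ha (by simpa using hx1) hc (by simpa using hy1) hu
  obtain ⟨d, hd, hxyd⟩ := hK (x * y) (mul_mem hx hy)
  refine (hdet.of_isConj (isConj_iff.2 ⟨h, ?_⟩)).not_isConj hd hxyd
  group

end ConjugateIntoFactor

section FreeFactors

variable {G : Type*} [Group G]

theorem map_eq_conjSubgroup_iff {Φ : G ≃* G} {A A' : Subgroup G} {g : G} :
    Subgroup.map Φ.toMonoidHom A = conjSubgroup g A' ↔ ∀ x, x ∈ A ↔ g⁻¹ * Φ x * g ∈ A' := by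
  have key : ∀ y, y ∈ conjSubgroup g A' ↔ g⁻¹ * y * g ∈ A' := fun y => by
    rw [conjSubgroup, Subgroup.mem_map_equiv, MulAut.conj_symm_apply]
  constructor
  · intro h x
    rw [← key, ← h, Subgroup.mem_map_equiv, MulEquiv.symm_apply_apply]
  · intro h
    ext y
    rw [key, Subgroup.mem_map_equiv, h, MulEquiv.apply_symm_apply]

theorem mulEquiv_pow_apply (Φ : G ≃* G) (m : ℕ) (x : G) : (Φ ^ m) x = Φ^[m] x := by
  induction m generalizing x with
  | zero => rfl
  | succ m ih => rw [pow_succ, Function.iterate_succ_apply, ← ih]; rfl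

variable {ι : Type*} (b : FreeGroupBasis ι G) {S : Set ι}

/-- A free factor is not conjugate to a proper subgroup of itself. -/
theorem inv_mul_mul_mem_of_forall_conj_mem {y : G}
    (hy : ∀ a ∈ Subgroup.closure (b '' S), y * a * y⁻¹ ∈ Subgroup.closure (b '' S)) {a : G}
    (ha : a ∈ Subgroup.closure (b '' S)) : y⁻¹ * a * y ∈ Subgroup.closure (b '' S) := by
  classical
  set A := Subgroup.closure (b '' S) with hA
  let r : G →* G := b.lift fun i => if i ∈ S then b i else 1
  have hr : ∀ a ∈ A, r a = a := by
    have : A ≤ MonoidHom.eqLocus r (MonoidHom.id G) := by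
      rw [hA, Subgroup.closure_le]
      rintro _ ⟨i, hi, rfl⟩
      change r (b i) = b i
      simp [r, hi]
    exact fun a ha => this ha
  have hrA : ∀ x, r x ∈ A := by
    have : ⊤ ≤ A.comap r := by
      rw [← b.closure_range_eq_top, Subgroup.closure_le]
      rintro _ ⟨i, rfl⟩
      change r (b i) ∈ A
      by_cases hi : i ∈ S
      · simpa [r, hi] using Subgroup.subset_closure (Set.mem_image_of_mem b hi)
      · simp [r, hi]
    exact fun x => this (Subgroup.mem_top x)
  have hz := mul_mem (mul_mem (inv_mem (hrA y)) ha) (hrA y)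
  have h := hr _ (hy _ hz)
  rw [map_mul, map_mul, map_inv, hr _ hz] at h
  have : y⁻¹ * a * y = (r y)⁻¹ * a * r y := by
    have h' : a = y * ((r y)⁻¹ * a * r y) * y⁻¹ := by
      rw [← h]
      group
    conv_lhs => rw [h']
    group
  rwa [this]

theorem conj_into_of_conj_into_iterate {Φ : G ≃* G}
    (hΦ : ∀ x, ∃ y : Abelianization G, Abelianization.of (Φ x) = Abelianization.of x * y ^ 3)
    {N : ℕ} (hN : 1 ≤ N) {g : G}
    (hg : ∀ x ∈ Subgroup.closure (b '' S), g⁻¹ * Φ^[N] x * g ∈ Subgroup.closure (b '' S)) {a : G}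
    (ha : a ∈ Subgroup.closure (b '' S)) :
    ∃ c ∈ Subgroup.closure (b '' S), IsConj (Φ a) c := by
  refine (exists_isConj_mem_or_detectedByTrace b (Φ a)).resolve_right ?_
  rintro ⟨R, _, ρ, τ, hρ, hτ, hA, hne⟩
  have hconj : ∀ k, ∃ c ∈ Subgroup.closure (b '' S), IsConj (Φ^[N * k] a) c := by
    intro k
    induction k with
    | zero => exact ⟨a, ha, IsConj.refl _⟩
    | succ k ih =>
      obtain ⟨c, hc, h⟩ := ih
      refine ⟨_, hg c hc, ?_⟩
      rw [mul_add_one, add_comm, Function.iterate_add_apply]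
      have h1 := (Φ ^ N).toMonoidHom.map_isConj h
      simp only [MulEquiv.toMonoidHom_eq_coe, MonoidHom.coe_coe, mulEquiv_pow_apply] at h1
      exact h1.trans (isConj_iff.2 ⟨g⁻¹, by simp⟩)
  refine hne (eq_zero_of_fwdDiff_dvd_of_periodic_zero (s := fun k => τ (ρ (Φ^[k] a)))
    (three_pow_dvd_fwdDiff_iter hρ τ (Φ := Φ.toMonoidHom) hΦ a) hN (fun k => ?_) 1)
  obtain ⟨c, hc, h⟩ := hconj k
  exact (trace_conj ρ hτ h).trans (hA c hc)

/-- A periodic free factor is invariant up to conjugacy. -/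
theorem free_factor_invariant_of_periodic {Φ : G ≃* G}
    (hΦ : ∀ x, ∃ y : Abelianization G, Abelianization.of (Φ x) = Abelianization.of x * y ^ 3)
    {N : ℕ} (hN : 1 ≤ N) {g : G}
    (hg : ∀ x, x ∈ Subgroup.closure (b '' S) ↔
      g⁻¹ * Φ^[N] x * g ∈ Subgroup.closure (b '' S)) :
    ∃ h : G, Subgroup.map Φ.toMonoidHom (Subgroup.closure (b '' S)) =
      conjSubgroup h (Subgroup.closure (b '' S)) := by
  set A := Subgroup.closure (b '' S) with hA
  obtain ⟨h, hh⟩ := exists_conj_le_of_forall_isConj b (S := S) (K := A.map Φ.toMonoidHom) (by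
    rintro _ ⟨a, ha, rfl⟩
    exact conj_into_of_conj_into_iterate b hΦ hN (fun x hx => (hg x).1 hx) ha)
  replace hh : ∀ a ∈ A, h * Φ a * h⁻¹ ∈ A := fun a ha => hh _ (Subgroup.mem_map_of_mem _ ha)
  have hiter : ∀ k, ∃ x : G, ∀ a ∈ A, x * (Φ ^ k) a * x⁻¹ ∈ A := by
    intro k
    induction k with
    | zero => exact ⟨1, fun a ha => by simpa using ha⟩
    | succ k ih =>
      obtain ⟨x, hx⟩ := ih
      refine ⟨x * (Φ ^ k) h, fun a ha => ?_⟩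
      have := hx _ (hh a ha)
      rw [pow_succ]
      change x * (Φ ^ k) h * (Φ ^ k) (Φ a) * (x * (Φ ^ k) h)⁻¹ ∈ A
      convert this using 1
      simp only [map_mul, map_inv]
      group
  obtain ⟨k, rfl⟩ : ∃ k, N = k + 1 := ⟨N - 1, by omega⟩
  obtain ⟨x, hx⟩ := hiter k
  have hpow : ∀ a, Φ^[k + 1] a = (Φ ^ k) (Φ a) := fun a => by
    rw [Function.iterate_succ_apply, mulEquiv_pow_apply]
  have hsurj : ∀ c ∈ A, ∃ a ∈ A, (Φ ^ k) (Φ a) = g * c * g⁻¹ := by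
    intro c hc
    obtain ⟨a, ha⟩ := ((Φ ^ k).surjective.comp Φ.surjective) (g * c * g⁻¹)
    rw [Function.comp_apply] at ha
    refine ⟨a, (hg a).2 ?_, ha⟩
    rw [hpow, ha]
    convert hc using 1
    group
  have hy : ∀ c ∈ A, (x * (Φ ^ k) h * g) * c * (x * (Φ ^ k) h * g)⁻¹ ∈ A := by
    intro c hc
    obtain ⟨a, ha, hac⟩ := hsurj c hc
    convert hx _ (hh a ha) using 1
    simp only [map_mul, map_inv, hac]
    group
  refine ⟨h⁻¹, map_eq_conjSubgroup_iff.2 fun a => ⟨fun ha => by simpa using hh a ha, fun ha => ?_⟩⟩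
  rw [inv_inv] at ha
  obtain ⟨a', ha', h'⟩ := hsurj _ (inv_mul_mul_mem_of_forall_conj_mem b hy (hx _ ha))
  have : (Φ ^ k) (Φ a') = (Φ ^ k) (Φ a) := by
    rw [h']
    simp only [map_mul, map_inv]
    group
  rwa [← Φ.injective ((Φ ^ k).injective this)]

theorem exists_basis_of_isFreeProductDecomp.{u} {G : Type u} [Group G] [IsFreeGroup G] {k : ℕ}
    {A : Fin k → Subgroup G} {B : Subgroup G} (h : IsFreeProductDecomp A B) (i : Fin k) :
    ∃ (ι : Type u) (b : FreeGroupBasis ι G) (S : Set ι), A i = Subgroup.closure (b '' S) := by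
  let X : Option (Fin k) → Subgroup G := fun o => Option.elim o B A
  let β := fun o => IsFreeGroup.basis (X o)
  let e := MulEquiv.ofBijective (Monoid.CoprodI.lift fun o => (X o).subtype) h
  refine ⟨_, (Monoid.CoprodI.FreeGroupBasis.coprodI β).map e, {x | x.1 = some i}, ?_⟩
  have hb : ∀ x, (Monoid.CoprodI.FreeGroupBasis.coprodI β).map e x = (β x.1 x.2 : G) := by
    intro x
    have : Monoid.CoprodI.FreeGroupBasis.coprodI β x =
        Monoid.CoprodI.of (M := fun o => X o) (β x.1 x.2) := by
      exact FreeGroup.lift_apply_of (f := fun x : Σ o, IsFreeGroup.Generators (X o) =>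
        Monoid.CoprodI.of (M := fun o => X o) (β x.1 x.2))
    rw [FreeGroupBasis.map_apply, this]
    exact Monoid.CoprodI.lift_of (fun o => (X o).subtype) _
  have hX := congrArg (Subgroup.map (X (some i)).subtype) (β (some i)).closure_range_eq_top
  rw [MonoidHom.map_closure, ← MonoidHom.range_eq_map, Subgroup.range_subtype] at hX
  change X (some i) = _
  rw [← hX]
  congr 1
  ext g
  constructor
  · rintro ⟨_, ⟨j, rfl⟩, rfl⟩
    exact ⟨⟨some i, j⟩, rfl, hb _⟩
  · rintro ⟨⟨o, j⟩, ho, rfl⟩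
    obtain rfl : o = some i := ho
    exact ⟨_, ⟨j, rfl⟩, (hb ⟨some i, j⟩).symm⟩

theorem exists_iterate_conj {k : ℕ} {A : Fin k → Subgroup G} {Ψ : G ≃* G} {σ : Fin k → Fin k}
    (h : ∀ i, ∃ g, ∀ x, x ∈ A i ↔ g⁻¹ * Ψ x * g ∈ A (σ i)) (t : ℕ) (i : Fin k) :
    ∃ g, ∀ x, x ∈ A i ↔ g⁻¹ * Ψ^[t] x * g ∈ A (σ^[t] i) := by
  induction t with
  | zero => exact ⟨1, by simp⟩
  | succ t ih =>
    obtain ⟨g, hg⟩ := ih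
    obtain ⟨g', hg'⟩ := h (σ^[t] i)
    refine ⟨Ψ g * g', fun x => ?_⟩
    rw [hg, hg', Function.iterate_succ_apply', Function.iterate_succ_apply']
    simp only [map_mul, map_inv, mul_inv_rev, mul_assoc]

theorem injective_of_not_conj {k : ℕ} {A : Fin k → Subgroup G} {Ψ : G ≃* G} {σ : Fin k → Fin k}
    (h : ∀ i, ∃ g, ∀ x, x ∈ A i ↔ g⁻¹ * Ψ x * g ∈ A (σ i))
    (hA : ∀ i j, i ≠ j → ∀ g : G, conjSubgroup g (A i) ≠ A j) : Function.Injective σ := by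
  intro i j hij
  by_contra hne
  obtain ⟨g, hg⟩ := h i
  obtain ⟨g', hg'⟩ := h j
  refine hA j i (Ne.symm hne) (Ψ.symm (g * g'⁻¹)) ?_
  ext x
  rw [conjSubgroup, Subgroup.mem_map_equiv, MulAut.conj_symm_apply, hg, hg', hij]
  simp [mul_assoc]

end FreeFactors

/-- Every `ψ`-periodic free factor system is `ψ`-invariant for `ψ ∈ IA_n(ℤ/3)`
(Theorem `ThmPeriodicFreeFactor` of the paper). -/
theorem periodic_free_factor_system_invariant {n k : ℕ} (hn : 1 ≤ n)
    (Φ : FreeGroup (Fin n) ≃* FreeGroup (Fin n))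
    (hΦ : ActsTriviallyOnH1Mod3 Φ)
    (A : Fin k → Subgroup (FreeGroup (Fin n))) (B : Subgroup (FreeGroup (Fin n)))
    (hdecomp : IsFreeProductDecomp A B)
    (hnontriv : ∀ i, A i ≠ ⊥)
    (hnonconj : ∀ i j, i ≠ j → ∀ g : FreeGroup (Fin n), conjSubgroup g (A i) ≠ A j)
    (hper : ∃ m : ℕ, 1 ≤ m ∧ ∀ i, ∃ j, ∃ g : FreeGroup (Fin n),
      Subgroup.map (Φ ^ m).toMonoidHom (A i) = conjSubgroup g (A j)) :
    ∀ i, ∃ j, ∃ h : FreeGroup (Fin n),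
      Subgroup.map Φ.toMonoidHom (A i) = conjSubgroup h (A j) := by
  obtain ⟨m, hm, hper⟩ := hper
  choose σ hσ using hper
  have hrel : ∀ i, ∃ g, ∀ x, x ∈ A i ↔ g⁻¹ * (Φ ^ m) x * g ∈ A (σ i) := fun i => by
    obtain ⟨g, hg⟩ := hσ i
    exact ⟨g, map_eq_conjSubgroup_iff.1 hg⟩
  let e : Equiv.Perm (Fin k) :=
    Equiv.ofBijective σ (Finite.injective_iff_bijective.1 (injective_of_not_conj hrel hnonconj))
  intro i
  obtain ⟨g, hg⟩ := exists_iterate_conj hrel (orderOf e) i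
  have hi : σ^[orderOf e] i = i := by
    change (⇑e)^[orderOf e] i = i
    rw [← Equiv.Perm.coe_pow, pow_orderOf_eq_one, Equiv.Perm.one_apply]
  have hiter : (⇑(Φ ^ m))^[orderOf e] = Φ^[m * orderOf e] := by
    rw [Function.iterate_mul]
    congr 1
    exact funext (mulEquiv_pow_apply Φ m)
  rw [hi, hiter] at hg
  obtain ⟨ι, b, S, hS⟩ := exists_basis_of_isFreeProductDecomp hdecomp i
  rw [hS] at hg
  obtain ⟨h, hh⟩ := free_factor_invariant_of_periodic b hΦ
    (Nat.mul_pos hm (orderOf_pos e)) hg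
  exact ⟨i, h, by rw [hS, hh]⟩
end

section
/- Let n ≥ 1, F := FreeGroup (Fin n), and let Φ : F ≃* F act trivially on H₁(F; ℤ/3). Let A : Fin k → Subgroup F and B ≤ F realize an internal free product decomposition of F representing a free factor system (each A i nontrivial, and the A i pairwise nonconjugate). Suppose the system is Φ-invariant: for every i there exist j and g ∈ F with Φ(A i) = g • (A j) • g⁻¹. Then each component is fixed: for every i there exists h ∈ F with Φ(A i) = h • (A i) • h⁻¹. (An element of IA_n(ℤ/3) fixes each component of each invariant free factor system; Lemma 'LemmaFFSComponent'(1) of the paper.) -/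
/-- A nontrivial free group has a nontrivial character to `ℤ/3`. -/
theorem IsFreeGroup.exists_hom_zmod_three_ne_one (H : Type*) [Group H] [IsFreeGroup H]
    [Nontrivial H] : ∃ (χ : H →* Multiplicative (ZMod 3)) (a : H), χ a ≠ 1 := by
  have hgen : Nonempty (IsFreeGroup.Generators H) := by
    by_contra h
    rw [not_nonempty_iff] at h
    exact not_subsingleton H (IsFreeGroup.toFreeGroup H).toEquiv.subsingleton
  obtain ⟨s⟩ := hgen
  refine ⟨IsFreeGroup.lift fun _ => Multiplicative.ofAdd 1, IsFreeGroup.of s, ?_⟩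
  rw [IsFreeGroup.lift_of]
  decide

/-- A character to `ℤ/3` is unchanged by an automorphism acting trivially on `H₁(F; ℤ/3)`. -/
theorem ActsTriviallyOnH1Mod3.hom_apply_eq {n : ℕ} {Φ : FreeGroup (Fin n) ≃* FreeGroup (Fin n)}
    (hΦ : ActsTriviallyOnH1Mod3 Φ) (ψ : FreeGroup (Fin n) →* Multiplicative (ZMod 3))
    (x : FreeGroup (Fin n)) : ψ (Φ x) = ψ x := by
  obtain ⟨y, hy⟩ := hΦ x
  have h := congrArg (Abelianization.lift ψ) hy
  have hcube : ∀ z : Multiplicative (ZMod 3), z ^ 3 = 1 := by decide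
  simpa [hcube] using h

/-- In a free product decomposition, a character of one component extends to the whole group so
that it kills the other components. -/
theorem IsFreeProductDecomp.exists_hom_extend {G M : Type*} [Group G] [Group M] {k : ℕ}
    {A : Fin k → Subgroup G} {B : Subgroup G} (h : IsFreeProductDecomp A B) (i : Fin k)
    (χ : A i →* M) : ∃ ψ : G →* M, (∀ a : A i, ψ a = χ a) ∧
      ∀ j, j ≠ i → ∀ a ∈ A j, ψ a = 1 := by
  classical
  let e := MulEquiv.ofBijective _ h
  let f : ∀ o : Option (Fin k), (Option.elim o B A : Subgroup G) →* M :=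
    Function.update (fun _ => 1) (some i) χ
  have key : ∀ (o : Option (Fin k)) (a : (Option.elim o B A : Subgroup G)),
      ((Monoid.CoprodI.lift f).comp e.symm.toMonoidHom) a = f o a := by
    intro o a
    let w : Monoid.CoprodI fun o : Option (Fin k) => (Option.elim o B A : Subgroup G) :=
      Monoid.CoprodI.of (i := o) a
    have he : e w = a :=
      Monoid.CoprodI.lift_of (fun o : Option (Fin k) => (Option.elim o B A).subtype) (i := o) a
    have hs : e.symm (a : G) = w := by rw [← he, e.symm_apply_apply]
    change Monoid.CoprodI.lift f (e.symm (a : G)) = f o a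
    rw [hs, Monoid.CoprodI.lift_of]
  refine ⟨_, fun a => (key (some i) a).trans ?_, fun j hj a ha => (key (some j) ⟨a, ha⟩).trans ?_⟩
  · have hf : f (some i) = χ := Function.update_self _ _ _
    rw [hf]
    rfl
  · have hf : f (some j) = 1 := Function.update_of_ne (by simpa using hj) _ _
    rw [hf]
    rfl

/-- An element of `IA_n(ℤ/3)` fixes each component of each invariant free factor
system (Lemma `LemmaFFSComponent`(1) of the paper). -/
theorem invariant_free_factor_system_components_fixed {n k : ℕ} (hn : 1 ≤ n)
    (Φ : FreeGroup (Fin n) ≃* FreeGroup (Fin n))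
    (hΦ : ActsTriviallyOnH1Mod3 Φ)
    (A : Fin k → Subgroup (FreeGroup (Fin n))) (B : Subgroup (FreeGroup (Fin n)))
    (hdecomp : IsFreeProductDecomp A B)
    (hnontriv : ∀ i, A i ≠ ⊥)
    (hnonconj : ∀ i j, i ≠ j → ∀ g : FreeGroup (Fin n), conjSubgroup g (A i) ≠ A j)
    (hinv : ∀ i, ∃ j, ∃ g : FreeGroup (Fin n),
      Subgroup.map Φ.toMonoidHom (A i) = conjSubgroup g (A j)) :
    ∀ i, ∃ h : FreeGroup (Fin n),
      Subgroup.map Φ.toMonoidHom (A i) = conjSubgroup h (A i) := by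
  intro i
  obtain ⟨j, g, hj⟩ := hinv i
  by_cases hji : j = i
  · exact ⟨g, hji ▸ hj⟩
  exfalso
  have : Nontrivial (A i) := (Subgroup.nontrivial_iff_ne_bot _).mpr (hnontriv i)
  obtain ⟨χ, a, ha⟩ := IsFreeGroup.exists_hom_zmod_three_ne_one (A i)
  obtain ⟨ψ, hψ, hψ'⟩ := hdecomp.exists_hom_extend i χ
  have hmem : Φ a ∈ conjSubgroup g (A j) := hj ▸ Subgroup.mem_map_of_mem Φ.toMonoidHom a.2
  obtain ⟨b, hb, hab⟩ := hmem
  replace hab : g * b * g⁻¹ = Φ a := hab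
  apply ha
  rw [← hψ a, ← hΦ.hom_apply_eq ψ a, ← hab, map_mul, map_mul, hψ' j hji b hb, mul_one, map_inv,
    mul_inv_cancel]
end
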